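/- Let (Z, δ) be a configuration of diameter at most 4 with no cut-vertex, let G be a planar triangulation, and let φ be an orientation-preserving homomorphism from (Z, δ) to G. If G has no obstructing cycle all of whose vertices lie in φ(V(Z)), then φ is injective, so (Z, δ) is cont45ained in G via the embedding φ; moreover, if (Z, δ) additionally satisfies that whenever u and w are vertices at Z-distance exactly 4, there is a length-4 path P joining them in Z such that either P is not contained in the outer face boundary of Z, or P = (u, v₁, v₂, v₃, w) lies in the outer face boundary and some vᵢ is not a cut-vertex and has δ(vᵢ) − d_Z(vᵢ) ≥ 2, then (Z, δ) is induced in G. -/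

import Mathlib

/-!
Common formal framework for statements from
"A near-linear time 4-coloring algorithm for planar graphs".

Plane embeddings are modelled combinatorially by rotation systems on darts
(Heffter–Edmonds): a graph together with a rotation system embeds in the
orientable surface whose faces are the orbits of the face-tracing permutation,
and the embedding is in the 2-sphere precisely when Euler's relation holds.
-/

namespace FourColor

open SimpleGraph

/-- Degree of a vertex, as the cardinality of its neighbour set. -/
noncomputable def vdeg {V : Type} (G : SimpleGraph V) (v : V) : ℕ :=
  (G.neighborSet v).ncard

/-- Dart reversal, as a permutation of the darts of a graph. -/
def dartRev {V : Type} (G : SimpleGraph V) : Equiv.Perm G.Dart where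
  toFun := SimpleGraph.Dart.symm
  invFun := SimpleGraph.Dart.symm
  left_inv d := SimpleGraph.Dart.symm_symm d
  right_inv d := SimpleGraph.Dart.symm_symm d

/-- A combinatorial embedding (rotation system) of a graph: a permutation of the
darts fixing tails, whose restriction to the darts out of each vertex is a
single cycle (the clockwise rotation around the vertex). -/
structure CombEmbedding {V : Type} (G : SimpleGraph V) where
  rot : Equiv.Perm G.Dart
  rot_fst : ∀ d : G.Dart, (rot d).toProd.1 = d.toProd.1
  rot_cyclic : ∀ d d' : G.Dart, d.toProd.1 = d'.toProd.1 → ∃ n : ℕ, (rot ^ n) d = d'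

namespace CombEmbedding

variable {V : Type} {G : SimpleGraph V}

/-- The face-tracing permutation of an embedding. -/
def facePerm (E : CombEmbedding G) : Equiv.Perm G.Dart :=
  (dartRev G).trans E.rot

/-- Two darts lie on the same face iff they are in the same orbit of the
face-tracing permutation. -/
def faceSetoid (E : CombEmbedding G) : Setoid G.Dart where
  r d d' := ∃ n : ℤ, (E.facePerm ^ n) d = d'
  iseqv := by
    refine ⟨fun d => ⟨0, by simp⟩, ?_, ?_⟩
    · rintro d d' ⟨n, h⟩
      refine ⟨-n, ?_⟩
      rw [← h, ← Equiv.Perm.mul_apply, ← zpow_add, neg_add_cancel, zpow_zero,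
        Equiv.Perm.one_apply]
    · rintro a b c ⟨m, h1⟩ ⟨n, h2⟩
      refine ⟨n + m, ?_⟩
      rw [← h2, ← h1, ← Equiv.Perm.mul_apply, ← zpow_add]

/-- The number of faces of an embedding. -/
noncomputable def numFaces (E : CombEmbedding G) : ℕ :=
  Nat.card (Quotient E.faceSetoid)

/-- Euler's relation characterising embeddings of a (possibly disconnected)
finite graph in the 2-sphere: `V - E + F = 2·(#components) - (#isolated vertices)`. -/
def IsSpherical [Fintype V] (E : CombEmbedding G) : Prop :=
  (Fintype.card V : ℤ) - (G.edgeSet.ncard : ℤ) + (E.numFaces : ℤ) =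
    2 * (Nat.card G.ConnectedComponent : ℤ) - (({v : V | ∀ w, ¬ G.Adj v w}).ncard : ℤ)

end CombEmbedding

/-- A finite simple graph is planar iff it admits a rotation system
satisfying Euler's relation for the sphere. -/
def IsPlanar {V : Type} [Fintype V] (G : SimpleGraph V) : Prop :=
  ∃ E : CombEmbedding G, E.IsSpherical

/-- A planar triangulation: a connected simple graph embedded in the 2-sphere
(Euler's relation) all of whose faces are triangles. -/
structure PlaneTriangulation (V : Type) [Fintype V] where
  graph : SimpleGraph V
  emb : CombEmbedding graph
  conn : graph.Connected
  euler : (Fintype.card V : ℤ) - (graph.edgeSet.ncard : ℤ) + (emb.numFaces : ℤ) = 2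
  faces_tri : ∀ d : graph.Dart, (emb.facePerm ^ 3) d = d ∧ emb.facePerm d ≠ d

/-- A near-triangulation: a connected plane graph, with a designated outer face,
all of whose faces except the outer one are triangles.  (The trivial
near-triangulations on a single vertex are allowed.) -/
structure NearTriangulation (V : Type) [Fintype V] where
  graph : SimpleGraph V
  emb : CombEmbedding graph
  conn : graph.Connected
  euler : Fintype.card V = 1 ∨
    (Fintype.card V : ℤ) - (graph.edgeSet.ncard : ℤ) + (emb.numFaces : ℤ) = 2
  /-- membership of a dart in the (boundary walk of the) outer face -/
  isOuter : graph.Dart → Prop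
  outer_closed : ∀ d, isOuter d → isOuter (emb.facePerm d)
  outer_single : ∀ d d', isOuter d → isOuter d' → ∃ n : ℕ, (emb.facePerm ^ n) d = d'
  outer_nonempty : ∀ _ : graph.Dart, ∃ d', isOuter d'
  inner_tri : ∀ d, ¬ isOuter d → (emb.facePerm ^ 3) d = d ∧ emb.facePerm d ≠ d

namespace NearTriangulation

variable {V : Type} [Fintype V]

/-- A vertex lies on the outer face boundary. -/
def OnOuter (N : NearTriangulation V) (v : V) : Prop :=
  IsEmpty N.graph.Dart ∨ ∃ d : N.graph.Dart, N.isOuter d ∧ d.toProd.1 = v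

/-- An edge lies on the outer face boundary. -/
def IsOuterEdge (N : NearTriangulation V) (x y : V) : Prop :=
  ∃ d : N.graph.Dart, N.isOuter d ∧ (d.toProd = (x, y) ∨ d.toProd = (y, x))

end NearTriangulation

/-- `v` is a cut-vertex of `G`: deleting it increases the number of
connected components. -/
def IsCutVertex {V : Type} (G : SimpleGraph V) (v : V) : Prop :=
  Nat.card G.ConnectedComponent <
    Nat.card (G.induce {w : V | w ≠ v}).ConnectedComponent

/-- A configuration `(Z, δ)`: a near-triangulation together with a degree
function which agrees with the degree at interior vertices, exceeds it at
outer vertices, and with at most one cut-vertex, lying in exactly two blocks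
and having external degree 2. -/
structure Configuration (V : Type) [Fintype V] extends NearTriangulation V where
  δ : V → ℕ
  delta_inner : ∀ v : V, ¬ toNearTriangulation.OnOuter v → δ v = vdeg graph v
  delta_outer : ∀ v : V, toNearTriangulation.OnOuter v → vdeg graph v < δ v
  cut_unique : ∀ u w : V, IsCutVertex graph u → IsCutVertex graph w → u = w
  cut_cond : ∀ v : V, IsCutVertex graph v →
    Nat.card (graph.induce {w : V | w ≠ v}).ConnectedComponent = 2 ∧
    δ v = vdeg graph v + 2

/-- The map induced on darts by an adjacency-preserving vertex map. -/
def dartMap {A V : Type} {ZG : SimpleGraph A} {G : SimpleGraph V} (f : A → V)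
    (h : ∀ ⦃a b : A⦄, ZG.Adj a b → G.Adj (f a) (f b)) (d : ZG.Dart) : G.Dart :=
  ⟨(f d.toProd.1, f d.toProd.2), h d.adj⟩

/-- An orientation-preserving homomorphism of a configuration into a plane
triangulation: adjacency-preserving, sending inner facial triangles to facial
triangles with the same orientation, and matching the prescribed degrees. -/
def IsConfigHomMap {A V : Type} [Fintype A] [Fintype V] (C : Configuration A)
    (T : PlaneTriangulation V) (f : A → V) : Prop :=
  ∃ h : ∀ ⦃a b : A⦄, C.graph.Adj a b → T.graph.Adj (f a) (f b),
    (∀ v : A, vdeg T.graph (f v) = C.δ v) ∧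
    (∀ d : C.graph.Dart, ¬ C.isOuter d →
      T.emb.facePerm (dartMap f h d) = dartMap f h (C.emb.facePerm d))

/-- `f` exhibits the configuration `C` as being contained in the plane
triangulation `T`: an injective orientation-preserving homomorphism matching
degrees; moreover at a cut-vertex the two incident edges of `T` not coming
from `C` are non-consecutive in the rotation. -/
def IsContainMap {A V : Type} [Fintype A] [Fintype V] (C : Configuration A)
    (T : PlaneTriangulation V) (f : A → V) : Prop :=
  Function.Injective f ∧ IsConfigHomMap C T f ∧
  ∀ v : A, IsCutVertex C.graph v →
    ∀ e e' : T.graph.Dart, e.toProd.1 = f v → e'.toProd.1 = f v →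
      (¬ ∃ a b : A, C.graph.Adj a b ∧ e.toProd = (f a, f b)) →
      (¬ ∃ a b : A, C.graph.Adj a b ∧ e'.toProd = (f a, f b)) →
      e ≠ e' → T.emb.rot e ≠ e'

/-- A configuration on a concrete finite vertex set. -/
def ConfigOn : Type := Σ n : ℕ, Configuration (Fin n)

/-- The configuration `C` is contained in `T` within the set `S` of vertices. -/
def ConfigOn.ContainedIn (C : ConfigOn) {V : Type} [Fintype V]
    (T : PlaneTriangulation V) (S : Set V) : Prop :=
  ∃ f : Fin C.1 → V, IsContainMap C.2 T f ∧ Set.range f ⊆ S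

/-- The configuration `C` is induced in `T` within the set `S` of vertices. -/
def ConfigOn.InducedIn (C : ConfigOn) {V : Type} [Fintype V]
    (T : PlaneTriangulation V) (S : Set V) : Prop :=
  ∃ f : Fin C.1 → V, IsContainMap C.2 T f ∧ Set.range f ⊆ S ∧
    ∀ a b : Fin C.1, T.graph.Adj (f a) (f b) → C.2.graph.Adj a b

/-- Paper condition (ii) of Lemma `induced-config`: any two vertices at
distance exactly 4 are joined by a length-4 path which either is not contained
in the outer face boundary, or contains an internal vertex which is not a
cut-vertex and has external degree at least 2. -/
def SecondNbrCond {A : Type} [Fintype A] (C : Configuration A) : Prop :=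
  ∀ u w : A, C.graph.dist u w = 4 →
    ∃ p : C.graph.Walk u w, p.IsPath ∧ p.length = 4 ∧
      ((¬ ∀ d ∈ p.darts, C.toNearTriangulation.IsOuterEdge d.toProd.1 d.toProd.2) ∨
        ∃ x ∈ p.support, x ≠ u ∧ x ≠ w ∧ ¬ IsCutVertex C.graph x ∧
          vdeg C.graph x + 2 ≤ C.δ x)

/-! ### Balls and obstructing cycles -/

/-- The set of vertices at distance at most `k` from `v` (vertex set of `B_k(v)`). -/
def ballSet {V : Type} (G : SimpleGraph V) (v : V) (k : ℕ) : Set V :=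
  {u | ∃ p : G.Walk v u, p.length ≤ k}

/-- Vertex set of the degree-bounded ball `B^8_k(v)`. -/
def dBallSet {V : Type} (G : SimpleGraph V) (v : V) (k : ℕ) : Set V :=
  {u | ∃ p : G.Walk v u, p.length ≤ k ∧ ∀ x ∈ p.support, x = v ∨ vdeg G x ≤ 8}

/-- Vertex set of the extended degree-bounded ball `B̄^8_k(v)`. -/
def extdBallSet {V : Type} (G : SimpleGraph V) (v : V) (k : ℕ) : Set V :=
  dBallSet G v k ∪
    {u | 9 ≤ vdeg G u ∧ ∃ p : G.Walk v u, p.length ≤ k ∧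
      ∀ x ∈ p.support, x = v ∨ x = u ∨ vdeg G x ≤ 8}

/-- An obstructing cycle: a cycle of length at most 4 with at least one vertex
on each of its two sides, or of length 5 with at least two vertices on each
side.  (The two sides of a cycle of a plane triangulation are unions of
components of the complement, with no edges from one side to the other.) -/
def IsObstructingCycle {V : Type} {G : SimpleGraph V} {x : V} (c : G.Walk x x) : Prop :=
  c.IsCycle ∧
  ∃ A B : Set V,
    (∀ v : V, v ∉ c.support → v ∈ A ∨ v ∈ B) ∧
    (∀ v ∈ A, v ∉ c.support) ∧ (∀ v ∈ B, v ∉ c.support) ∧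
    Disjoint A B ∧
    (∀ a ∈ A, ∀ b ∈ B, ¬ G.Adj a b) ∧
    ((c.length ≤ 4 ∧ A.Nonempty ∧ B.Nonempty) ∨
      (c.length = 5 ∧ 2 ≤ A.ncard ∧ 2 ≤ B.ncard))

/-- `G` has an obstructing cycle all of whose vertices lie in `S`. -/
def HasObstructingCycleIn {V : Type} (G : SimpleGraph V) (S : Set V) : Prop :=
  ∃ (x : V) (c : G.Walk x x), IsObstructingCycle c ∧ ∀ y ∈ c.support, y ∈ S

/-- A chordless cycle: every edge of `G` between vertices of the cycle is an
edge of the cycle. -/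
def IsChordless {V : Type} {G : SimpleGraph V} {x : V} (c : G.Walk x x) : Prop :=
  ∀ u v : V, u ∈ c.support → v ∈ c.support → G.Adj u v → s(u, v) ∈ c.edges

/-- Two vertex sets touch: they share a vertex, or an edge of `G` joins them. -/
def Touches {V : Type} (G : SimpleGraph V) (S S' : Set V) : Prop :=
  (S ∩ S').Nonempty ∨ ∃ s ∈ S, ∃ t ∈ S', G.Adj s t

/-- A `k`-local obstructing cycle around `v`, with designated public part
`pub`: the cycle lies in `B̄^8_k(v)`, the public part consists of at most two
vertices which are consecutive on the cycle, and everything outside the public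
part (the private part) lies in `B^8_k(v)`. -/
def IsLocalObstructing {V : Type} (G : SimpleGraph V) (v : V) (k : ℕ) {x : V}
    (c : G.Walk x x) (pub : Set V) : Prop :=
  IsObstructingCycle c ∧
  (∀ y ∈ c.support, y ∈ extdBallSet G v k) ∧
  pub ⊆ {y | y ∈ c.support} ∧
  pub.ncard ≤ 2 ∧
  (∀ y ∈ pub, ∀ z ∈ pub, y ≠ z → s(y, z) ∈ c.edges) ∧
  (∀ y ∈ c.support, y ∉ pub → y ∈ dBallSet G v k)

/-! ### Discharging and charges -/

/-- Initial charge `T₀(v) = 10·(6 − d(v))`. -/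
noncomputable def initialCharge {V : Type} (G : SimpleGraph V) (v : V) : ℤ :=
  10 * (6 - (vdeg G v : ℤ))

/-- Final charge of `v`, given the function `send u v` recording the total
charge sent from `u` to `v` by the discharging rules (`send u v = 0` for
non-adjacent `u, v`). -/
noncomputable def finalCharge {V : Type} [Fintype V] (G : SimpleGraph V)
    (send : V → V → ℤ) (v : V) : ℤ :=
  initialCharge G v + ∑ u : V, (send u v - send v u)

/-- A discharging assignment: for every plane triangulation, an amount of
charge sent along each ordered pair of vertices, nonnegative and vanishing on
non-adjacent pairs.  (The paper's fixed set `ℛ` of 43 discharging rules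
determines such an assignment.) -/
def IsDischargeAssignment
    (Φ : ∀ (V : Type) [Fintype V], PlaneTriangulation V → V → V → ℤ) : Prop :=
  ∀ (V : Type) [Fintype V] (T : PlaneTriangulation V) (u v : V),
    (¬ T.graph.Adj u v → Φ V T u v = 0) ∧ 0 ≤ Φ V T u v

/-! ### Colorings and Kempe changes -/

/-- A proper 4-coloring. -/
def IsProperColoring {U : Type} (G : SimpleGraph U) (c : U → Fin 4) : Prop :=
  ∀ ⦃u v : U⦄, G.Adj u v → c u ≠ c v

/-- `u` and `w` lie in a common `ab`-Kempe chain inside `S`. -/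
def KempeConnOn {U : Type} (G : SimpleGraph U) (S : Set U) (c : U → Fin 4)
    (a b : Fin 4) (u w : U) : Prop :=
  ∃ p : G.Walk u w, ∀ x ∈ p.support, x ∈ S ∧ (c x = a ∨ c x = b)

/-- A Kempe change (within the vertex set `S`): for complementary color pairs
`{a,b}` and `{e,f}`, swap the two colors on some `ab`-Kempe chains and some
`ef`-Kempe chains. -/
def IsKempeChangeOn {U : Type} (G : SimpleGraph U) (S : Set U)
    (c c' : U → Fin 4) : Prop :=
  (∀ v ∉ S, c' v = c v) ∧
  ∃ a b e f : Fin 4, ({a, b, e, f} : Set (Fin 4)) = Set.univ ∧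
    (∀ v ∈ S, c' v = c v ∨ (c v = a ∧ c' v = b) ∨ (c v = b ∧ c' v = a) ∨
      (c v = e ∧ c' v = f) ∨ (c v = f ∧ c' v = e)) ∧
    (∀ u w : U, (KempeConnOn G S c a b u w ∨ KempeConnOn G S c e f u w) →
      ((c' u = c u) ↔ (c' w = c w)))

/-- A Kempe change. -/
def IsKempeChange {U : Type} (G : SimpleGraph U) (c c' : U → Fin 4) : Prop :=
  IsKempeChangeOn G Set.univ c c'

/-- A single Kempe change: swap two colors on one Kempe chain. -/
def IsSingleKempeChange {U : Type} (G : SimpleGraph U) (c c' : U → Fin 4) : Prop :=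
  ∃ a b : Fin 4, a ≠ b ∧ ∃ u₀ : U, (c u₀ = a ∨ c u₀ = b) ∧
    ∀ v : U,
      (KempeConnOn G Set.univ c a b u₀ v →
        ((c v = a ∧ c' v = b) ∨ (c v = b ∧ c' v = a))) ∧
      (¬ KempeConnOn G Set.univ c a b u₀ v → c' v = c v)

/-- Two colorings agree up to a permutation of the colors. -/
def ColorPermEq {α : Type} (κ κ' : α → Fin 4) : Prop :=
  ∃ σ : Equiv.Perm (Fin 4), ∀ x : α, κ' x = σ (κ x)

/-! ### Free completions, rings, reducibility -/

/-- A free completion of the configuration `C`, with ring vertex set `W`: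
a near-triangulation on `A ⊕ W` whose outer face is the ring cycle on `W`
(disjoint from `C`), containing `C` with the prescribed degrees and inner
faces. -/
structure FreeCompletion {A : Type} [Fintype A] (C : Configuration A)
    (W : Type) [Fintype W] where
  nt : NearTriangulation (A ⊕ W)
  ring_outer : ∀ x : A ⊕ W, nt.OnOuter x ↔ ∃ w : W, x = Sum.inr w
  outer_simple : ∀ d d' : nt.graph.Dart, nt.isOuter d → nt.isOuter d' →
    d.toProd.1 = d'.toProd.1 → d = d'
  adj_iff : ∀ a b : A, nt.graph.Adj (Sum.inl a) (Sum.inl b) ↔ C.graph.Adj a b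
  deg_eq : ∀ a : A, vdeg nt.graph (Sum.inl a) = C.δ a
  faces_comm : ∀ d : C.graph.Dart, ¬ C.isOuter d →
    nt.emb.facePerm (dartMap Sum.inl (fun a b hab => (adj_iff a b).mpr hab) d) =
      dartMap Sum.inl (fun a b hab => (adj_iff a b).mpr hab) (C.emb.facePerm d)
  ring_edges_outer : ∀ w w' : W, nt.graph.Adj (Sum.inr w) (Sum.inr w') →
    ∃ d : nt.graph.Dart, nt.isOuter d ∧
      ((d.toProd.1 = Sum.inr w ∧ d.toProd.2 = Sum.inr w') ∨
       (d.toProd.1 = Sum.inr w' ∧ d.toProd.2 = Sum.inr w))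

namespace FreeCompletion

variable {A W : Type} [Fintype A] [Fintype W] {C : Configuration A}

/-- Adjacency on the ring. -/
def RingAdj (FC : FreeCompletion C W) (w w' : W) : Prop :=
  FC.nt.graph.Adj (Sum.inr w) (Sum.inr w')

/-- A proper 4-coloring of the ring. -/
def RingProper (FC : FreeCompletion C W) (κ : W → Fin 4) : Prop :=
  ∀ w w' : W, FC.RingAdj w w' → κ w ≠ κ w'

end FreeCompletion

/-- `j` embeds a cycle into `G'` so that its image bounds a face of the
embedding `E'`. -/
def IsFacialEmbedding {W U : Type} {G' : SimpleGraph U} (E' : CombEmbedding G')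
    (j : W → U) : Prop :=
  ∃ F : Set G'.Dart, F.Nonempty ∧ (∀ d ∈ F, E'.facePerm d ∈ F) ∧
    (∀ d ∈ F, ∀ d' ∈ F, ∃ n : ℕ, (E'.facePerm ^ n) d = d') ∧
    (∀ w : W, ∃ d ∈ F, d.toProd.1 = j w) ∧
    (∀ d ∈ F, (∃ w : W, d.toProd.1 = j w) ∧ (∃ w : W, d.toProd.2 = j w))

/-- `i`-extendibility of a ring coloring `κ` (Birkhoff–Kempe reducibility):
`κ` is `0`-extendible if it extends to a proper 4-coloring of the free
completion; it is `(i+1)`-extendible if it is `i`-extendible or if, for every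
plane graph `G'` containing the ring as a facial cycle and every proper
4-coloring of `G'` extending `κ`, some Kempe change yields a coloring whose
restriction to the ring is `i`-extendible. -/
def FreeCompletion.Extendible {A W : Type} [Fintype A] [Fintype W]
    {C : Configuration A} (FC : FreeCompletion C W) :
    ℕ → (W → Fin 4) → Prop
  | 0, κ => ∃ c : A ⊕ W → Fin 4, IsProperColoring FC.nt.graph c ∧
      ∀ w : W, c (Sum.inr w) = κ w
  | (i + 1), κ => FreeCompletion.Extendible FC i κ ∨
      ∀ (U : Type) [Fintype U] (G' : SimpleGraph U) (E' : CombEmbedding G'),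
        E'.IsSpherical →
        ∀ j : W → U, Function.Injective j →
          (∀ w w' : W, FC.RingAdj w w' ↔ G'.Adj (j w) (j w')) →
          IsFacialEmbedding E' j →
          ∀ c : U → Fin 4, IsProperColoring G' c → (∀ w : W, c (j w) = κ w) →
            ∃ c' : U → Fin 4, IsProperColoring G' c' ∧ IsKempeChange G' c c' ∧
              FreeCompletion.Extendible FC i (fun w => c' (j w))

/-- The reducibility level of a ring coloring: the least `i` such that it is
`i`-extendible. -/
noncomputable def FreeCompletion.level {A W : Type} [Fintype A] [Fintype W]
    {C : Configuration A} (FC : FreeCompletion C W) (κ : W → Fin 4) : ℕ :=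
  sInf {i : ℕ | FC.Extendible i κ}

/-- A configuration is D-reducible if, for some finite `i`, every proper
4-coloring of the ring of any free completion is `i`-extendible. -/
def DReducible {A : Type} [Fintype A] (C : Configuration A) : Prop :=
  ∃ i : ℕ, ∀ (W : Type) [Fintype W] (FC : FreeCompletion C W) (κ : W → Fin 4),
    FC.RingProper κ → FC.Extendible i κ

/-- The defining properties of the paper's fixed set `𝒟` of 8202 D-reducible
configurations: each has at most 19 vertices, diameter at most 4, at most one
vertex of (prescribed) degree exceeding 8, ring size at most 18, and every
4-coloring of its ring is 25-extendible. -/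
def DSetGood (𝓓 : Set ConfigOn) : Prop :=
  𝓓.ncard = 8202 ∧
  ∀ C ∈ 𝓓,
    C.1 ≤ 19 ∧
    (∀ a b : Fin C.1, C.2.graph.dist a b ≤ 4) ∧
    ({v : Fin C.1 | 8 < C.2.δ v}).ncard ≤ 1 ∧
    ∃ (r : ℕ) (FC : FreeCompletion C.2 (Fin r)), r ≤ 18 ∧
      ∀ κ : Fin r → Fin 4, FC.RingProper κ → FC.Extendible 25 κ

end FourColor

/-! ### Cycles bound on a spherical map -/

namespace FourColor

open SimpleGraph

/-- The functions into `ZMod 2` that are invariant under a permutation. -/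
def invariantFunctions {D : Type} (π : Equiv.Perm D) : Submodule (ZMod 2) (D → ZMod 2) where
  carrier := {h | ∀ d, h (π d) = h d}
  add_mem' ha hb d := by simp [ha d, hb d]
  zero_mem' d := by simp
  smul_mem' c h hh d := by simp [hh d]

theorem zmod_two_eq_add_of_add_eq {a b c : ZMod 2} (h : a + b = c) : a = b + c := by
  rw [← h, add_comm a b, ← add_assoc, CharTwo.add_self_eq_zero, zero_add]

theorem zmod_two_eq_of_add_eq_zero {a b : ZMod 2} (h : a + b = 0) : a = b := by
  simpa using zmod_two_eq_add_of_add_eq h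

/-- If every `π`-invariant function factors through the `π`-invariant surjection `p`, then the
invariant functions form a space whose dimension is the size of the target of `p`. -/
theorem finrank_invariantFunctions {D Q : Type} [Finite D] [Finite Q] (π : Equiv.Perm D)
    (p : D → Q) (hp : Function.Surjective p) (hπ : ∀ d, p (π d) = p d)
    (hfib : ∀ h : D → ZMod 2, (∀ d, h (π d) = h d) → ∀ d d', p d = p d' → h d = h d') :
    Module.finrank (ZMod 2) (invariantFunctions π) = Nat.card Q := by
  have := Fintype.ofFinite Q
  let e : invariantFunctions π ≃ₗ[ZMod 2] (Q → ZMod 2) :=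
    { toFun := fun h q => h.1 (Function.surjInv hp q)
      map_add' := fun _ _ => rfl
      map_smul' := fun _ _ => rfl
      invFun := fun k => ⟨fun d => k (p d), fun d => by simp [hπ]⟩
      left_inv := fun h => by
        ext d
        exact hfib h.1 h.2 _ _ (Function.surjInv_eq hp _)
      right_inv := fun k => by
        ext q
        simp [Function.surjInv_eq hp] }
  rw [e.finrank_eq, Module.finrank_fintype_fun_eq_card, Nat.card_eq_fintype_card]

/-- Vanishing of the first homology of a sphere: on a connected combinatorial map with vertex
permutation `σ`, edge involution `α` and face permutation `σ ∘ α` satisfying Euler's relation,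
each cycle is the boundary of a set of faces. -/
theorem exists_boundary_of_cycle {D : Type} [Fintype D] [Nonempty D] (σ α φ : Equiv.Perm D)
    (hα : ∀ d, α (α d) = d) (hfix : ∀ d, α d ≠ d) (hφ : ∀ d, φ d = σ (α d))
    (hconn : ∀ h : D → ZMod 2, (∀ d, h (σ d) = h d) → (∀ d, h (α d) = h d) →
      ∀ d d', h d = h d')
    (heuler : Fintype.card D + 4 ≤ 2 * Module.finrank (ZMod 2) (invariantFunctions σ) +
      2 * Module.finrank (ZMod 2) (invariantFunctions φ))
    (hedges : Fintype.card D = 2 * Module.finrank (ZMod 2) (invariantFunctions α))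
    (g : D → ZMod 2) (hg : ∀ d, g (α d) = g d)
    (hcyc : ∀ w : D → ZMod 2, (∀ d, w (σ d) = w d) → ∑ d, g d * w d = 0) :
    ∃ h : D → ZMod 2, (∀ d, h (φ d) = h d) ∧ ∀ d, h d + h (α d) = g d := by
  classical
  let B : LinearMap.BilinForm (ZMod 2) (D → ZMod 2) := dotProductBilin (ZMod 2) (ZMod 2)
  have hB : ∀ x y, B x y = ∑ d, x d * y d := fun x y => rfl
  have hnd : B.Nondegenerate := by
    constructor
    · intro x hx
      ext d
      simpa [hB, Pi.single_apply] using hx (Pi.single d 1)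
    · intro x hx
      ext d
      simpa [hB, Pi.single_apply] using hx (Pi.single d 1)
  obtain ⟨d₀⟩ := ‹Nonempty D›
  let K := invariantFunctions (D := D)
  let δ : (D → ZMod 2) →ₗ[ZMod 2] (D → ZMod 2) :=
    { toFun := fun h d => h d + h (α d)
      map_add' := fun x y => by ext d; simp; ring
      map_smul' := fun c x => by ext d; simp; ring }
  have hδ : ∀ h d, δ h d = h d + h (α d) := fun _ _ => rfl
  have hle : (K φ).map δ ≤ B.orthogonal (K α ⊔ K σ) := by
    rintro _ ⟨h, hh, rfl⟩
    rw [LinearMap.BilinForm.mem_orthogonal_iff]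
    intro w hw
    obtain ⟨a, ha, b, hb, rfl⟩ := Submodule.mem_sup.1 hw
    have h1 : ∑ d, a d * δ h d = 0 := by
      refine Finset.sum_involution (fun d _ => α d) ?_ (fun d _ _ => hfix d)
        (fun _ _ => Finset.mem_univ _) (fun d _ => hα d)
      intro d _
      rw [hδ, hδ, hα, ha d, add_comm (h (α d)), CharTwo.add_self_eq_zero]
    have h2 : ∑ d, b d * δ h d = 0 := by
      have : ∑ d, b d * h (α d) = ∑ d, b d * h d := by
        rw [← Equiv.sum_comp σ (fun d => b d * h d)]
        refine Finset.sum_congr rfl fun d _ => ?_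
        have := hh (α d)
        rw [hφ, hα] at this
        rw [this, hb d]
      simp only [hδ, mul_add, Finset.sum_add_distrib, this, CharTwo.add_self_eq_zero]
    change B (a + b) (δ h) = 0
    rw [map_add, LinearMap.add_apply, hB, hB, h1, h2, add_zero]
  have hker : Module.finrank (ZMod 2) (K φ) ≤
      Module.finrank (ZMod 2) ((K φ).map δ) + 1 := by
    have h1 := LinearMap.finrank_range_add_finrank_ker (δ.domRestrict (K φ))
    rw [LinearMap.range_domRestrict] at h1
    have h2 : Module.finrank (ZMod 2) (δ.domRestrict (K φ)).ker ≤ 1 := by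
      rw [← Module.finrank_self (ZMod 2)]
      refine LinearMap.finrank_le_finrank_of_injective
        (f := LinearMap.proj d₀ ∘ₗ (K φ).subtype ∘ₗ (δ.domRestrict (K φ)).ker.subtype) ?_
      rw [← LinearMap.ker_eq_bot, LinearMap.ker_eq_bot']
      rintro ⟨⟨h, hh⟩, hk⟩ h0
      have h0 : h d₀ = 0 := h0
      have hk : δ h = 0 := hk
      have hhα : ∀ d, h (α d) = h d := fun d =>
        (zmod_two_eq_of_add_eq_zero (congrFun hk d)).symm
      have hhσ : ∀ d, h (σ d) = h d := fun d => by
        have := hh (α d)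
        rwa [hφ, hα, hhα] at this
      ext d
      exact (hconn h hhσ hhα d d₀).trans h0
    omega
  have hinf : Module.finrank (ZMod 2) ↥(K α ⊓ K σ) ≤ 1 := by
    rw [← Module.finrank_self (ZMod 2)]
    refine LinearMap.finrank_le_finrank_of_injective
      (f := LinearMap.proj d₀ ∘ₗ (K α ⊓ K σ).subtype) ?_
    rw [← LinearMap.ker_eq_bot, LinearMap.ker_eq_bot']
    rintro ⟨h, hh⟩ h0
    ext d
    exact (hconn h hh.2 hh.1 d d₀).trans h0
  have hsum := Submodule.finrank_sup_add_finrank_inf_eq (K α) (K σ)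
  have horth := LinearMap.BilinForm.finrank_orthogonal hnd (K α ⊔ K σ)
  have hle' := Submodule.finrank_le (K α ⊔ K σ)
  rw [Module.finrank_fintype_fun_eq_card] at horth hle'
  have heq := Submodule.eq_of_le_of_finrank_le hle (by
    simp only [K] at *
    omega)
  have hgm : g ∈ B.orthogonal (K α ⊔ K σ) := by
    rw [LinearMap.BilinForm.mem_orthogonal_iff]
    intro w hw
    obtain ⟨a, ha, b, hb, rfl⟩ := Submodule.mem_sup.1 hw
    have h1 : ∑ d, a d * g d = 0 := by
      refine Finset.sum_involution (fun d _ => α d) ?_ (fun d _ _ => hfix d)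
        (fun _ _ => Finset.mem_univ _) (fun d _ => hα d)
      intro d _
      rw [hg, ha d, CharTwo.add_self_eq_zero]
    have h2 : ∑ d, b d * g d = 0 := by
      simpa only [mul_comm] using hcyc b hb
    change B (a + b) g = 0
    rw [map_add, LinearMap.add_apply, hB, hB, h1, h2, add_zero]
  rw [← heq] at hgm
  obtain ⟨h, hh, rfl⟩ := hgm
  exact ⟨h, hh, fun d => rfl⟩

namespace CombEmbedding

variable {V : Type} {G : SimpleGraph V}

theorem facePerm_apply (E : CombEmbedding G) (d : G.Dart) : E.facePerm d = E.rot d.symm := rfl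

theorem facePerm_symm (E : CombEmbedding G) (d : G.Dart) : E.facePerm d.symm = E.rot d := by
  rw [facePerm_apply, Dart.symm_symm]

theorem rot_pow_fst (E : CombEmbedding G) (n : ℕ) (d : G.Dart) :
    ((E.rot ^ n) d).fst = d.fst := by
  induction n with
  | zero => rfl
  | succ n ih => rw [pow_succ', Equiv.Perm.mul_apply, E.rot_fst, ih]

theorem eq_of_rot_invariant {X : Type} (E : CombEmbedding G) {h : G.Dart → X}
    (hh : ∀ d, h (E.rot d) = h d) {d d' : G.Dart} (hd : d.fst = d'.fst) : h d = h d' := by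
  obtain ⟨n, rfl⟩ := E.rot_cyclic d d' hd
  clear hd
  induction n with
  | zero => rfl
  | succ n ih => rw [pow_succ', Equiv.Perm.mul_apply, hh, ih]

theorem eq_of_invariant {X : Type} (E : CombEmbedding G) (hG : G.Connected) {h : G.Dart → X}
    (hh : ∀ d, h (E.rot d) = h d) (hs : ∀ d, h d.symm = h d) (d d' : G.Dart) : h d = h d' := by
  obtain ⟨p⟩ := hG.preconnected d.fst d'.fst
  generalize hu : d.fst = u at p
  generalize hw : d'.fst = w at p
  induction p generalizing d with
  | nil => exact E.eq_of_rot_invariant hh (hu.trans hw.symm)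
  | @cons a b c hab p ih =>
    rw [E.eq_of_rot_invariant (d' := ⟨(a, b), hab⟩) hh hu, ← hs]
    exact ih _ rfl hw

theorem exists_dart_fst (hG : G.Connected) (d₀ : G.Dart) (v : V) : ∃ d : G.Dart, d.fst = v := by
  obtain ⟨p⟩ := hG.preconnected v d₀.fst
  cases p with
  | nil => exact ⟨d₀, rfl⟩
  | cons h p => exact ⟨⟨(_, _), h⟩, rfl⟩

theorem finrank_rot [Fintype V] (E : CombEmbedding G) (hG : G.Connected) (d₀ : G.Dart) :
    Module.finrank (ZMod 2) (invariantFunctions E.rot) = Fintype.card V := by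
  classical
  rw [finrank_invariantFunctions E.rot (fun d => d.fst) (exists_dart_fst hG d₀) E.rot_fst
    (fun h hh d d' hd => E.eq_of_rot_invariant hh hd), Nat.card_eq_fintype_card]

theorem finrank_facePerm [Fintype V] (E : CombEmbedding G) :
    Module.finrank (ZMod 2) (invariantFunctions E.facePerm) = E.numFaces := by
  classical
  refine finrank_invariantFunctions E.facePerm (Quotient.mk E.faceSetoid)
    Quotient.mk_surjective (fun d => Quotient.sound ⟨-1, by simp⟩) ?_
  intro h hh d d' hd
  obtain ⟨n, rfl⟩ := Quotient.exact hd
  clear hd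
  induction n with
  | zero => simp
  | succ n ih => rw [ih, add_comm, zpow_add, zpow_one, Equiv.Perm.mul_apply, hh]
  | pred n ih =>
    rw [ih, ← hh ((E.facePerm ^ (-(n : ℤ) - 1)) d), ← Equiv.Perm.mul_apply,
      ← zpow_one_add, add_sub_cancel]

theorem two_mul_finrank_dartRev [Fintype V] :
    Nat.card G.Dart = 2 * Module.finrank (ZMod 2) (invariantFunctions (dartRev G)) ∧
      Nat.card G.Dart = 2 * G.edgeSet.ncard := by
  classical
  have h : Nat.card G.Dart = 2 * G.edgeSet.ncard := by
    rw [Nat.card_eq_fintype_card, G.dart_card_eq_twice_card_edges, ← coe_edgeFinset,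
      Set.ncard_coe_finset]
  refine ⟨?_, h⟩
  rw [h, finrank_invariantFunctions (dartRev G) (Q := G.edgeSet)
    (fun d => ⟨d.edge, d.edge_mem⟩) ?_ (fun d => Subtype.ext (Dart.edge_symm d)) ?_]
  · rfl
  · rintro ⟨e, he⟩
    induction e with | h a b => exact ⟨⟨(a, b), he⟩, rfl⟩
  · intro h hh d d' hd
    rcases (dart_edge_eq_iff d d').1 (congrArg Subtype.val hd) with rfl | rfl
    · rfl
    · exact hh d'

theorem exists_face_potential [Fintype V] (E : CombEmbedding G) (hG : G.Connected)
    (heuler : (Fintype.card V : ℤ) - (G.edgeSet.ncard : ℤ) + (E.numFaces : ℤ) = 2)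
    (g : G.Dart → ZMod 2) (hg : ∀ d, g d.symm = g d)
    (hcyc : ∀ w : V → ZMod 2, ∑ᶠ d : G.Dart, g d * w d.fst = 0) :
    ∃ h : G.Dart → ZMod 2, (∀ d, h (E.facePerm d) = h d) ∧ ∀ d, h d + h d.symm = g d := by
  classical
  rcases isEmpty_or_nonempty G.Dart with hD | ⟨⟨d₀⟩⟩
  · exact ⟨0, fun _ => rfl, fun d => isEmptyElim d⟩
  have := Nonempty.intro d₀
  obtain ⟨h1, h2⟩ := two_mul_finrank_dartRev (G := G)
  rw [Nat.card_eq_fintype_card] at h1 h2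
  refine exists_boundary_of_cycle E.rot (dartRev G) E.facePerm Dart.symm_symm Dart.symm_ne
    (fun d => rfl) (fun h hr hs => E.eq_of_invariant hG hr hs) ?_ h1 g hg ?_
  · rw [E.finrank_rot hG d₀, E.finrank_facePerm]
    omega
  · intro w hw
    choose s hs using exists_dart_fst hG d₀
    rw [← hcyc fun v => w (s v), finsum_eq_sum_of_fintype]
    exact Finset.sum_congr rfl fun d _ => by
      rw [E.eq_of_rot_invariant (d' := d) hw (hs _)]

theorem exists_vertex_potential [Fintype V] (E : CombEmbedding G) (hG : G.Connected)
    (heuler : (Fintype.card V : ℤ) - (G.edgeSet.ncard : ℤ) + (E.numFaces : ℤ) = 2)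
    (g : G.Dart → ZMod 2) (hg : ∀ d, g d.symm = g d)
    (hcyc : ∀ w : G.Dart → ZMod 2, (∀ d, w (E.facePerm d) = w d) → ∑ᶠ d, g d * w d = 0) :
    ∃ p : V → ZMod 2, ∀ d : G.Dart, p d.fst + p d.snd = g d := by
  classical
  rcases isEmpty_or_nonempty G.Dart with hD | ⟨⟨d₀⟩⟩
  · exact ⟨0, fun d => isEmptyElim d⟩
  have := Nonempty.intro d₀
  obtain ⟨h1, h2⟩ := two_mul_finrank_dartRev (G := G)
  rw [Nat.card_eq_fintype_card] at h1 h2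
  obtain ⟨h, hh, hgh⟩ := exists_boundary_of_cycle E.facePerm (dartRev G) E.rot Dart.symm_symm
    Dart.symm_ne (fun d => (E.facePerm_symm d).symm)
    (fun h hr hs => E.eq_of_invariant hG (fun d => by
      rw [← E.facePerm_symm, hr]; exact hs d) hs) (by
      rw [E.finrank_rot hG d₀, E.finrank_facePerm]
      omega) h1 g hg (fun w hw => by rw [← hcyc w hw, finsum_eq_sum_of_fintype])
  choose s hs using exists_dart_fst hG d₀
  refine ⟨fun v => h (s v), fun d => ?_⟩
  rw [← hgh d, ← E.eq_of_rot_invariant (d' := d) hh (hs d.fst),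
    ← E.eq_of_rot_invariant (d' := dartRev G d) hh (hs d.snd)]

end CombEmbedding

theorem sum_edge_eq_mul {V : Type} [Fintype V] [DecidableEq V] {G : SimpleGraph V}
    [Fintype G.Dart] {u v : V} (huv : G.Adj u v) (w : V → ZMod 2) :
    ∑ d : G.Dart, (if s(u, v) = d.edge then 1 else 0) * w d.fst = w u + w v := by
  classical
  let d₀ : G.Dart := ⟨(u, v), huv⟩
  have hd₀ : d₀ ≠ d₀.symm := (Dart.symm_ne d₀).symm
  have h : ∀ d : G.Dart, s(u, v) = d.edge ↔ d = d₀ ∨ d = d₀.symm := fun d => by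
    rw [eq_comm, ← dart_edge_eq_iff]; rfl
  simp_rw [h, ite_mul, one_mul, zero_mul]
  rw [← Finset.sum_filter, show Finset.univ.filter (fun d => d = d₀ ∨ d = d₀.symm) =
    {d₀, d₀.symm} by ext; simp, Finset.sum_pair hd₀]
  rfl

theorem sum_count_edges_mul {V : Type} [Fintype V] [DecidableEq V] {G : SimpleGraph V}
    [Fintype G.Dart] {x y : V} (p : G.Walk x y) (w : V → ZMod 2) :
    ∑ d : G.Dart, (p.edges.count d.edge : ZMod 2) * w d.fst = w x + w y := by
  induction p with
  | nil => simp [CharTwo.add_self_eq_zero]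
  | @cons u v z huv p ih =>
    have : ∀ d : G.Dart, (((Walk.cons huv p).edges.count d.edge : ℕ) : ZMod 2) * w d.fst =
        (p.edges.count d.edge : ZMod 2) * w d.fst +
          (if s(u, v) = d.edge then 1 else 0) * w d.fst := fun d => by
      rw [Walk.edges_cons, List.count_cons, ← add_mul]
      simp
    simp_rw [this]
    rw [Finset.sum_add_distrib, ih, sum_edge_eq_mul huv]
    linear_combination CharTwo.add_self_eq_zero (w v)

/-- `p`, `q`, `r` is a facial triangle of `E` with this orientation, in the form of `r` following
`p` in the rotation around `q`. -/
def CombEmbedding.FaceAt {V : Type} {G : SimpleGraph V} (E : CombEmbedding G) (p q r : V) : Prop :=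
  ∃ (h₁ : G.Adj q p) (h₂ : G.Adj q r), E.rot ⟨(q, p), h₁⟩ = ⟨(q, r), h₂⟩

theorem CombEmbedding.faceAt_facePerm {V : Type} {G : SimpleGraph V} (E : CombEmbedding G)
    (d : G.Dart) : E.FaceAt d.fst d.snd (E.facePerm d).snd := by
  have h : (E.facePerm d).fst = d.snd := E.rot_fst d.symm
  refine ⟨d.adj.symm, h ▸ (E.facePerm d).adj, ?_⟩
  ext
  · exact h
  · rfl

namespace PlaneTriangulation

variable {V : Type} [Fintype V] (T : PlaneTriangulation V)

theorem faceAt_rotate {T : PlaneTriangulation V} {p q r : V} (h : T.emb.FaceAt p q r) :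
    T.emb.FaceAt q r p := by
  obtain ⟨hqp, hqr, hrot⟩ := h
  let d : T.graph.Dart := ⟨(p, q), hqp.symm⟩
  have h1 : T.emb.facePerm d = ⟨(q, r), hqr⟩ := hrot
  have h2 := T.emb.faceAt_facePerm (T.emb.facePerm d)
  have h3 : (T.emb.facePerm (T.emb.facePerm d)).snd = p := by
    have := (T.faces_tri d).1
    rw [pow_succ', pow_two, Equiv.Perm.mul_apply, Equiv.Perm.mul_apply] at this
    have h4 : (T.emb.facePerm (T.emb.facePerm (T.emb.facePerm d))).fst =
      (T.emb.facePerm (T.emb.facePerm d)).snd := T.emb.rot_fst _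
    rw [← h4, this]
  rw [h3, h1] at h2
  exact h2

/-- The two sides of a cycle in a plane triangulation, as a two-colouring of the faces. -/
theorem exists_sides {x : V} (c : T.graph.Walk x x) (hc : c.IsCycle) :
    ∃ h : T.graph.Dart → ZMod 2, (∀ d, h (T.emb.facePerm d) = h d) ∧
      (∀ d, d.edge ∈ c.edges → h d + h d.symm = 1) ∧
      ∀ d, d.edge ∉ c.edges → h d.symm = h d := by
  classical
  obtain ⟨h, hh, hg⟩ := T.emb.exists_face_potential T.conn T.euler
    (fun d => (c.edges.count d.edge : ZMod 2)) (fun d => by rw [Dart.edge_symm])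
    (fun w => by
      rw [finsum_eq_sum_of_fintype, sum_count_edges_mul, CharTwo.add_self_eq_zero])
  refine ⟨h, hh, fun d hd => ?_, fun d hd => ?_⟩
  · rw [hg, List.count_eq_one_of_mem hc.edges_nodup hd, Nat.cast_one]
  · have := hg d
    rw [List.count_eq_zero_of_not_mem hd, Nat.cast_zero] at this
    exact (zmod_two_eq_of_add_eq_zero this).symm

/-- A non-obstructing cycle of length at most 5 has a side containing no vertex other than
possibly, for length 5, a single vertex `v₀`; the edges of the cycle all bound triangles on that
side. -/
theorem exists_small_side {x : V} (c : T.graph.Walk x x) (hc : c.IsCycle) (hlen : c.length ≤ 5)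
    (hno : ¬ IsObstructingCycle c) :
    ∃ v₀, (c.length ≤ 4 → v₀ ∈ c.support) ∧ ∀ p q, s(p, q) ∈ c.edges →
      ∃ r, (r ∈ c.support ∨ r = v₀) ∧ (T.emb.FaceAt p q r ∨ T.emb.FaceAt q p r) := by
  obtain ⟨h, hface, hin, hout⟩ := T.exists_sides c hc
  have hne : ∀ d : T.graph.Dart, d.fst ∉ c.support → d.edge ∉ c.edges := fun d hd he =>
    hd (c.fst_mem_support_of_mem_edges he)
  have hrot : ∀ d d' : T.graph.Dart, d.fst = d'.fst → d.fst ∉ c.support → h d = h d' := by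
    intro d d' hdd hd
    obtain ⟨n, rfl⟩ := T.emb.rot_cyclic d d' hdd
    clear hdd
    induction n with
    | zero => rfl
    | succ n ih =>
      rw [pow_succ', Equiv.Perm.mul_apply, ← CombEmbedding.facePerm_symm, hface, hout, ih]
      exact hne _ (by rwa [T.emb.rot_pow_fst])
  have h01 : ∀ i : ZMod 2, i = 0 ∨ i = 1 := by decide
  let A : Set V := {v | v ∉ c.support ∧ ∀ d : T.graph.Dart, d.fst = v → h d = 0}
  let B : Set V := {v | v ∉ c.support ∧ ∃ d : T.graph.Dart, d.fst = v ∧ h d = 1}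
  have hAB : ∀ v, v ∉ c.support → v ∈ A ∨ v ∈ B := by
    intro v hv
    by_cases hvB : ∃ d : T.graph.Dart, d.fst = v ∧ h d = 1
    · exact Or.inr ⟨hv, hvB⟩
    · exact Or.inl ⟨hv, fun d hd => (h01 _).resolve_right fun h1 => hvB ⟨d, hd, h1⟩⟩
  have hdisj : Disjoint A B := Set.disjoint_left.2 fun v hA ⟨_, d, hd, h1⟩ => by
    rw [hA.2 d hd] at h1
    exact zero_ne_one h1
  have hadj : ∀ a ∈ A, ∀ b ∈ B, ¬ T.graph.Adj a b := by
    rintro a ⟨ha, hA⟩ b ⟨hb, d, hd, h1⟩ hab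
    have h0 := hA ⟨(a, b), hab⟩ rfl
    have h2 := hout ⟨(a, b), hab⟩ (hne _ ha)
    rw [h0, hrot _ d hd.symm hb, h1] at h2
    exact one_ne_zero h2
  have hsmall : ∃ (i : ZMod 2) (v₀ : V), (c.length ≤ 4 → v₀ ∈ c.support) ∧
      ∀ d : T.graph.Dart, d.fst ∉ c.support → h d = i → d.fst = v₀ := by
    have key : ∀ S : Set V, S = A ∨ S = B → (S = ∅ ∨ (4 < c.length ∧ S.ncard ≤ 1)) →
        ∃ v₀ : V, (c.length ≤ 4 → v₀ ∈ c.support) ∧ ∀ v ∈ S, v = v₀ := by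
      rintro S - (rfl | ⟨hl, hS⟩)
      · exact ⟨x, fun _ => c.start_mem_support, by simp⟩
      · rcases S.eq_empty_or_nonempty with rfl | ⟨v, hv⟩
        · exact ⟨x, fun _ => c.start_mem_support, by simp⟩
        · exact ⟨v, fun h => absurd hl h.not_gt, fun u hu => (Set.ncard_le_one).1 hS u hu v hv⟩
    have hsmallAB : (A = ∅ ∨ (4 < c.length ∧ A.ncard ≤ 1)) ∨
        (B = ∅ ∨ (4 < c.length ∧ B.ncard ≤ 1)) := by
      by_contra! hcon
      obtain ⟨⟨hA, hA'⟩, hB, hB'⟩ := hcon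
      refine hno ⟨hc, A, B, hAB, fun v hv => hv.1, fun v hv => hv.1, hdisj, hadj, ?_⟩
      by_cases hl : c.length ≤ 4
      · exact Or.inl ⟨hl, hA, hB⟩
      · exact Or.inr ⟨by omega, hA' (by omega), hB' (by omega)⟩
    rcases hsmallAB with hS | hS
    · obtain ⟨v₀, h4, hv₀⟩ := key A (Or.inl rfl) hS
      exact ⟨0, v₀, h4, fun d hd h0 =>
        hv₀ _ ⟨hd, fun d' hd' => by rw [← h0]; exact hrot _ _ hd' (hd' ▸ hd)⟩⟩
    · obtain ⟨v₀, h4, hv₀⟩ := key B (Or.inr rfl) hS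
      exact ⟨1, v₀, h4, fun d hd h1 => hv₀ _ ⟨hd, d, rfl, h1⟩⟩
  obtain ⟨i, v₀, h4, hv₀⟩ := hsmall
  have hthird : ∀ d : T.graph.Dart, h d = i →
      ∃ r, (r ∈ c.support ∨ r = v₀) ∧ T.emb.FaceAt d.fst d.snd r := by
    intro d hd
    refine ⟨_, ?_, T.emb.faceAt_facePerm d⟩
    by_cases hr : (T.emb.facePerm d).snd ∈ c.support
    · exact Or.inl hr
    · have hfst : (T.emb.facePerm (T.emb.facePerm d)).fst = (T.emb.facePerm d).snd :=
        T.emb.rot_fst _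
      right
      rw [← hfst] at hr ⊢
      exact hv₀ _ hr (by rw [hface, hface, hd])
  refine ⟨v₀, h4, fun p q hpq => ?_⟩
  let d : T.graph.Dart := ⟨(p, q), c.adj_of_mem_edges hpq⟩
  have htwo : ∀ i a b : ZMod 2, a + b = 1 → a = i ∨ b = i := by decide
  have hsides := htwo i _ _ (hin d hpq)
  rcases hsides with hd | hd
  · obtain ⟨r, hr, hf⟩ := hthird d hd
    exact ⟨r, hr, Or.inl hf⟩
  · obtain ⟨r, hr, hf⟩ := hthird d.symm hd
    exact ⟨r, hr, Or.inr hf⟩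

end PlaneTriangulation

open Classical in
/-- The darts with a given tail. -/
noncomputable def dartsAt {V : Type} [Fintype V] (G : SimpleGraph V) (x : V) : Finset G.Dart :=
  Finset.univ.filter fun d => d.fst = x

theorem mem_dartsAt {V : Type} [Fintype V] {G : SimpleGraph V} {x : V} {d : G.Dart} :
    d ∈ dartsAt G x ↔ d.fst = x := by simp [dartsAt]

theorem card_dartsAt {V : Type} [Fintype V] (G : SimpleGraph V) (x : V) :
    (dartsAt G x).card = vdeg G x := by
  classical
  rw [vdeg, ← G.coe_neighborFinset, Set.ncard_coe_finset, G.card_neighborFinset_eq_degree,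
    ← G.dart_fst_fiber_card_eq_degree]
  congr 1

namespace CombEmbedding

variable {V : Type} [Fintype V] {G : SimpleGraph V} (E : CombEmbedding G)

theorem isCycleOn_dartsAt (x : V) : E.rot.IsCycleOn (dartsAt G x) := by
  refine ⟨⟨fun d hd => ?_, E.rot.injective.injOn, fun d hd => ⟨E.rot.symm d, ?_, by simp⟩⟩,
    fun d hd d' hd' => ?_⟩
  · simpa [mem_dartsAt, E.rot_fst] using hd
  · have := E.rot_fst (E.rot.symm d)
    rw [Equiv.apply_symm_apply] at this
    simpa [mem_dartsAt, ← this] using hd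
  · simp only [SetLike.mem_coe, mem_dartsAt] at hd hd'
    obtain ⟨n, hn⟩ := E.rot_cyclic d d' (hd.trans hd'.symm)
    exact ⟨n, by simpa using hn⟩

theorem rot_pow_apply_eq_iff (d : G.Dart) {m n : ℕ} :
    (E.rot ^ m) d = (E.rot ^ n) d ↔ m ≡ n [MOD vdeg G d.fst] := by
  rw [(E.isCycleOn_dartsAt d.fst).pow_apply_eq_pow_apply (mem_dartsAt.2 rfl), card_dartsAt]

theorem rot_pow_injOn (d : G.Dart) {m n : ℕ} (hm : m < vdeg G d.fst) (hn : n < vdeg G d.fst)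
    (h : (E.rot ^ m) d = (E.rot ^ n) d) : m = n :=
  ((E.rot_pow_apply_eq_iff d).1 h).eq_of_lt_of_lt hm hn

theorem exists_rot_pow_eq {d d' : G.Dart} (h : d.fst = d'.fst) :
    ∃ n < vdeg G d.fst, (E.rot ^ n) d = d' := by
  rw [← card_dartsAt]
  exact (E.isCycleOn_dartsAt d.fst).exists_pow_eq (mem_dartsAt.2 rfl) (mem_dartsAt.2 h.symm)

end CombEmbedding

namespace NearTriangulation

variable {A : Type} [Fintype A] (N : NearTriangulation A)

theorem isOuter_facePerm_iff {d : N.graph.Dart} : N.isOuter (N.emb.facePerm d) ↔ N.isOuter d := by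
  refine ⟨fun h => ?_, N.outer_closed d⟩
  have hpow : ∀ n : ℕ, N.isOuter ((N.emb.facePerm ^ n) (N.emb.facePerm d)) := by
    intro n
    induction n with
    | zero => exact h
    | succ n ih =>
      rw [pow_succ', Equiv.Perm.mul_apply]
      exact N.outer_closed _ ih
  have := hpow (orderOf N.emb.facePerm - 1)
  classical
  rwa [← Equiv.Perm.mul_apply, ← pow_succ, Nat.sub_add_cancel (orderOf_pos _), pow_orderOf_eq_one,
    Equiv.Perm.one_apply] at this

theorem onOuter_iff (d : N.graph.Dart) :
    N.OnOuter d.fst ↔ ∃ e : N.graph.Dart, e.fst = d.fst ∧ N.isOuter e.symm := by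
  constructor
  · rintro (h | ⟨e, he, hed⟩)
    · exact h.elim d
    · refine ⟨N.emb.rot.symm e, ?_, ?_⟩
      · rw [← hed, ← N.emb.rot_fst, Equiv.apply_symm_apply]
      · rwa [← N.isOuter_facePerm_iff, CombEmbedding.facePerm_symm, Equiv.apply_symm_apply]
  · rintro ⟨e, he, hout⟩
    refine Or.inr ⟨N.emb.rot e, ?_, by rw [N.emb.rot_fst]; exact he⟩
    rw [← CombEmbedding.facePerm_symm]
    exact N.outer_closed _ hout

/-- The outer face has at most one corner at a vertex that is not a cut-vertex. -/
theorem outer_corner_unique {e₁ e₂ : N.graph.Dart} (hx : ¬ IsCutVertex N.graph e₁.fst)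
    (h : e₁.fst = e₂.fst) (h₁ : N.isOuter e₁.symm) (h₂ : N.isOuter e₂.symm) : e₁ = e₂ := by
  classical
  by_contra hne
  obtain ⟨m, hm, rfl⟩ := N.emb.exists_rot_pow_eq h
  have hm0 : m ≠ 0 := by rintro rfl; exact hne rfl
  have heuler := N.euler.resolve_left fun hcard => by
    have := Fintype.card_le_one_iff.1 hcard.le
    exact e₁.adj.ne (this _ _)
  set σ := N.emb.rot with hσ
  let g : N.graph.Dart → ZMod 2 := fun d => ∑ j ∈ Finset.range m,
    ((if d = (σ ^ (j + 1)) e₁ then 1 else 0) + (if d.symm = (σ ^ (j + 1)) e₁ then 1 else 0))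
  have hfst : ∀ d : N.graph.Dart, d.fst ≠ e₁.fst → ∀ j, d ≠ (σ ^ j) e₁ := by
    rintro _ hd j rfl
    exact hd (N.emb.rot_pow_fst _ _)
  obtain ⟨p, hp⟩ := N.emb.exists_vertex_potential N.conn heuler g
    (fun d => Finset.sum_congr rfl fun j _ => by rw [Dart.symm_symm, add_comm]) (fun w hw => by
      rw [finsum_eq_sum_of_fintype]
      simp only [g, Finset.sum_mul]
      rw [Finset.sum_comm]
      have hterm : ∀ e : N.graph.Dart,
          ∑ d : N.graph.Dart, ((if d = e then 1 else 0) + (if d.symm = e then 1 else 0)) * w d =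
            w e + w (σ e) := fun e => by
        have : ∀ d : N.graph.Dart, d.symm = e ↔ d = e.symm := fun d =>
          Dart.symm_involutive.eq_iff
        simp only [this, add_mul, ite_mul, one_mul, zero_mul, Finset.sum_add_distrib,
          Finset.sum_ite_eq', Finset.mem_univ, if_true]
        rw [← hw e.symm, CombEmbedding.facePerm_symm]
      simp only [hterm]
      have htel : ∀ m : ℕ, ∑ j ∈ Finset.range m,
          (w ((σ ^ (j + 1)) e₁) + w (σ ((σ ^ (j + 1)) e₁))) =
            w (σ e₁) + w (σ ((σ ^ m) e₁)) := by
        intro m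
        induction m with
        | zero => simp [CharTwo.add_self_eq_zero]
        | succ m ih =>
          rw [Finset.sum_range_succ, ih, pow_succ', Equiv.Perm.mul_apply]
          linear_combination CharTwo.add_self_eq_zero (w (σ ((σ ^ m) e₁)))
      have hout : ∀ d d', N.isOuter d → N.isOuter d' → w d = w d' := by
        intro d d' hd hd'
        obtain ⟨n, rfl⟩ := N.outer_single d d' hd hd'
        clear hd'
        induction n with
        | zero => rfl
        | succ n ih => rw [pow_succ', Equiv.Perm.mul_apply, hw, ih]
      rw [htel, ← CombEmbedding.facePerm_symm, ← CombEmbedding.facePerm_symm, hw, hw,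
        hout _ _ h₁ h₂, CharTwo.add_self_eq_zero])
  have hg₁ : g e₁ = 0 := by
    refine Finset.sum_eq_zero fun j hj => ?_
    rw [if_neg, if_neg, add_zero]
    · exact hfst _ e₁.adj.ne' _
    · intro hj'
      have := N.emb.rot_pow_injOn e₁ (m := 0) (n := j + 1) (by omega)
        (by have := Finset.mem_range.1 hj; omega) hj'
      omega
  have hg₂ : g ((σ ^ m) e₁) = 1 := by
    have hs : ∀ j, ((σ ^ m) e₁).symm ≠ (σ ^ j) e₁ := hfst _ (by
      rw [h]; exact ((σ ^ m) e₁).adj.ne')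
    simp only [g, hs, if_false, add_zero]
    rw [Finset.sum_eq_single (m - 1), Nat.sub_add_cancel (by omega), if_pos rfl]
    · intro j hj hjm
      refine if_neg fun hj' => hjm ?_
      have := N.emb.rot_pow_injOn e₁ hm (by have := Finset.mem_range.1 hj; omega) hj'
      omega
    · intro hmem
      exact absurd (Finset.mem_range.2 (by omega)) hmem
  have hpne : p e₁.snd ≠ p ((σ ^ m) e₁).snd := by
    have h1 := hp e₁
    have h2 := hp ((σ ^ m) e₁)
    rw [hg₁] at h1
    rw [hg₂, ← h] at h2
    intro hcon
    rw [← hcon, h1] at h2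
    exact zero_ne_one h2
  have hconn : Nat.card N.graph.ConnectedComponent = 1 := by
    have := N.conn.preconnected.subsingleton_connectedComponent
    have := N.conn.nonempty
    exact Nat.card_unique
  rw [IsCutVertex, hconn, not_lt, Finite.card_le_one_iff_subsingleton] at hx
  have hreach : ∀ a b : {w : A | w ≠ e₁.fst},
      (N.graph.induce {w : A | w ≠ e₁.fst}).Walk a b → p a = p b := by
    intro a b q
    induction q with
    | nil => rfl
    | @cons u v _ huv q ih =>
      rw [← ih]
      refine zmod_two_eq_of_add_eq_zero ((hp ⟨(u.1, v.1), huv⟩).trans ?_)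
      refine Finset.sum_eq_zero fun j hj => ?_
      rw [if_neg, if_neg, add_zero]
      · exact hfst (Dart.symm ⟨(u.1, v.1), huv⟩) v.2 _
      · exact hfst ⟨(u.1, v.1), huv⟩ u.2 _
  obtain ⟨q⟩ := ConnectedComponent.exact (Subsingleton.elim
    ((N.graph.induce {w : A | w ≠ e₁.fst}).connectedComponentMk ⟨e₁.snd, e₁.adj.ne'⟩)
    ((N.graph.induce {w : A | w ≠ e₁.fst}).connectedComponentMk
      ⟨((σ ^ m) e₁).snd, by
        rw [Set.mem_ofPred_eq, h]
        exact ((σ ^ m) e₁).adj.ne'⟩))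
  exact hpne (hreach _ _ q)

end NearTriangulation

section Star

variable {A V : Type} [Fintype A] [Fintype V] {C : Configuration A} {T : PlaneTriangulation V}
  {f : A → V} {h : ∀ ⦃a b : A⦄, C.graph.Adj a b → T.graph.Adj (f a) (f b)}

theorem dartMap_rot
    (hface : ∀ d : C.graph.Dart, ¬ C.isOuter d →
      T.emb.facePerm (dartMap f h d) = dartMap f h (C.emb.facePerm d))
    {d : C.graph.Dart} (hd : ¬ C.isOuter d.symm) :
    dartMap f h (C.emb.rot d) = T.emb.rot (dartMap f h d) := by
  rw [← CombEmbedding.facePerm_symm, ← hface _ hd]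
  rfl

variable (hdeg : ∀ v : A, vdeg T.graph (f v) = C.δ v)
  (hface : ∀ d : C.graph.Dart, ¬ C.isOuter d →
    T.emb.facePerm (dartMap f h d) = dartMap f h (C.emb.facePerm d))
include hface

/-- The star of a non-cut-vertex, listed as a fan: the rotation lists the darts in order, with the
outer face, if present, in the gap between the last dart and the first. -/
theorem exists_fan {x : A} (hx : ¬ IsCutVertex C.graph x) {d : C.graph.Dart} (hd : d.fst = x) :
    ∃ s : C.graph.Dart, s.fst = x ∧
      (∀ k, k + 1 < vdeg C.graph x → ¬ C.isOuter ((C.emb.rot ^ k) s).symm) ∧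
      (∀ k, k < vdeg C.graph x →
        dartMap f h ((C.emb.rot ^ k) s) = (T.emb.rot ^ k) (dartMap f h s)) ∧
      (vdeg C.graph x < C.δ x ∨
        vdeg C.graph x = C.δ x ∧ ∀ e : C.graph.Dart, e.fst = x → ¬ C.isOuter e.symm) := by
  have hpow : ∀ s : C.graph.Dart,
      (∀ k, k + 1 < vdeg C.graph x → ¬ C.isOuter ((C.emb.rot ^ k) s).symm) →
      ∀ k, k < vdeg C.graph x →
        dartMap f h ((C.emb.rot ^ k) s) = (T.emb.rot ^ k) (dartMap f h s) := by
    intro s hs k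
    induction k with
    | zero => intro _; rfl
    | succ k ih =>
      intro hk
      rw [pow_succ', pow_succ', Equiv.Perm.mul_apply, Equiv.Perm.mul_apply, ← ih (by omega)]
      exact dartMap_rot hface (hs k hk)
  have hon := C.onOuter_iff d
  rw [hd] at hon
  by_cases hout : ∃ e : C.graph.Dart, e.fst = x ∧ C.isOuter e.symm
  · obtain ⟨e, he, heo⟩ := hout
    have hs : ∀ k, k + 1 < vdeg C.graph x →
        ¬ C.isOuter ((C.emb.rot ^ k) (C.emb.rot e)).symm := by
      intro k hk ho
      rw [← Equiv.Perm.mul_apply, ← pow_succ] at ho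
      have heq := C.outer_corner_unique (he.symm ▸ hx) (C.emb.rot_pow_fst _ _).symm heo ho
      have := C.emb.rot_pow_injOn e (m := 0) (n := k + 1) (by rw [he]; omega)
        (by rw [he]; exact hk) heq
      omega
    exact ⟨C.emb.rot e, (C.emb.rot_fst e).trans he, hs, hpow _ hs,
      Or.inl (C.delta_outer x (hon.2 ⟨e, he, heo⟩))⟩
  · have hin : ∀ e : C.graph.Dart, e.fst = x → ¬ C.isOuter e.symm :=
      fun e he ho => hout ⟨e, he, ho⟩
    have hs : ∀ k, k + 1 < vdeg C.graph x → ¬ C.isOuter ((C.emb.rot ^ k) d).symm :=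
      fun k _ => hin _ ((C.emb.rot_pow_fst k d).trans hd)
    exact ⟨d, hd, hs, hpow _ hs, Or.inr ⟨(C.delta_inner x fun ho => hout (hon.1 ho)).symm, hin⟩⟩

include hdeg

theorem dartMap_injOn_star {d d' : C.graph.Dart} (hx : ¬ IsCutVertex C.graph d.fst)
    (hd : d'.fst = d.fst) (heq : dartMap f h d = dartMap f h d') : d = d' := by
  obtain ⟨s, hs, -, hmap, hδ⟩ := exists_fan hface hx rfl
  obtain ⟨k, hk, rfl⟩ := C.emb.exists_rot_pow_eq hs
  obtain ⟨j, hj, rfl⟩ := C.emb.exists_rot_pow_eq (hs.trans hd.symm)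
  rw [hs] at hk hj
  rw [hmap k hk, hmap j hj] at heq
  have hdT : vdeg T.graph (dartMap f h s).fst = C.δ s.fst := hdeg _
  rw [hs] at hdT
  rw [T.emb.rot_pow_injOn _ (by omega) (by omega) heq]

theorem rot_eq_of_rot_dartMap_eq {d d' : C.graph.Dart} (hx : ¬ IsCutVertex C.graph d.fst)
    (hd : d'.fst = d.fst) (heq : T.emb.rot (dartMap f h d) = dartMap f h d') :
    ¬ C.isOuter d.symm ∧ C.emb.rot d = d' := by
  suffices hin : ¬ C.isOuter d.symm by
    refine ⟨hin, dartMap_injOn_star hdeg hface ?_ ?_ ?_⟩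
    · rwa [C.emb.rot_fst]
    · rw [C.emb.rot_fst, hd]
    · rw [dartMap_rot hface hin, heq]
  obtain ⟨s, hs, hgap, hmap, hδ⟩ := exists_fan hface hx rfl
  rcases hδ with hδ | ⟨-, hin⟩
  · obtain ⟨k, hk, rfl⟩ := C.emb.exists_rot_pow_eq hs
    obtain ⟨j, hj, rfl⟩ := C.emb.exists_rot_pow_eq (hs.trans hd.symm)
    rw [hs] at hk hj
    rw [hmap k hk, hmap j hj, ← Equiv.Perm.mul_apply, ← pow_succ'] at heq
    have hdT : vdeg T.graph (dartMap f h s).fst = C.δ s.fst := hdeg _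
    rw [hs] at hdT
    have := T.emb.rot_pow_injOn _ (by omega) (by omega) heq
    exact hgap k (by omega)
  · exact hin d rfl

theorem exists_dartMap_eq_rot {d d' : C.graph.Dart} (hx : ¬ IsCutVertex C.graph d.fst)
    (hd : d'.fst = d.fst) (hδ : vdeg C.graph d.fst + 2 ≤ C.δ d.fst)
    (heq : T.emb.rot (T.emb.rot (dartMap f h d)) = dartMap f h d') :
    ∃ e : C.graph.Dart, e.fst = d.fst ∧ dartMap f h e = T.emb.rot (dartMap f h d) := by
  obtain ⟨s, hs, hgap, hmap, -⟩ := exists_fan hface hx rfl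
  obtain ⟨k, hk, hkd⟩ := C.emb.exists_rot_pow_eq hs
  obtain ⟨j, hj, hjd⟩ := C.emb.exists_rot_pow_eq (hs.trans hd.symm)
  rw [hs] at hk hj
  have hsucc : ∀ e, T.emb.rot (T.emb.rot ((T.emb.rot ^ k) e)) = (T.emb.rot ^ (k + 2)) e :=
    fun e => by rw [pow_succ', pow_succ']; rfl
  rw [← hkd, ← hjd, hmap k hk, hmap j hj, hsucc] at heq
  have hdT : vdeg T.graph (dartMap f h s).fst = C.δ s.fst := hdeg _
  rw [hs] at hdT
  have := T.emb.rot_pow_injOn _ (by omega) (by omega) heq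
  refine ⟨(C.emb.rot ^ (k + 1)) s, (C.emb.rot_pow_fst _ _).trans hs, ?_⟩
  rw [hmap _ (by omega), pow_succ', Equiv.Perm.mul_apply, ← hmap k hk, hkd]

end Star

section Vertices

variable {A V : Type} [Fintype A] [Fintype V] {C : Configuration A} {T : PlaneTriangulation V}
  {f : A → V}

namespace IsConfigHomMap

theorem eq_of_common_neighbor (hf : IsConfigHomMap C T f) {a x b : A}
    (hx : ¬ IsCutVertex C.graph x) (ha : C.graph.Adj x a) (hb : C.graph.Adj x b)
    (hab : f a = f b) : a = b := by
  obtain ⟨h, hdeg, hface⟩ := hf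
  have := dartMap_injOn_star (h := h) hdeg hface (d := ⟨(x, a), ha⟩) (d' := ⟨(x, b), hb⟩) hx rfl
    (Dart.ext _ _ (by simp [dartMap, hab]))
  exact congrArg (fun d : C.graph.Dart => d.snd) this

theorem adj_of_faceAt (hf : IsConfigHomMap C T f) {a x b : A}
    (hx : ¬ IsCutVertex C.graph x) (ha : C.graph.Adj x a) (hb : C.graph.Adj x b)
    (hab : T.emb.FaceAt (f a) (f x) (f b)) : C.graph.Adj a b := by
  obtain ⟨h, hdeg, hface⟩ := hf
  obtain ⟨h₁, h₂, hrot⟩ := hab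
  obtain ⟨hin, heq⟩ := rot_eq_of_rot_dartMap_eq (h := h) hdeg hface (d := ⟨(x, a), ha⟩)
    (d' := ⟨(x, b), hb⟩) hx rfl hrot
  have h3 := (C.inner_tri _ hin).1
  rw [pow_succ', pow_two, Equiv.Perm.mul_apply, Equiv.Perm.mul_apply,
    CombEmbedding.facePerm_symm, heq] at h3
  have h4 : (C.emb.facePerm (C.emb.facePerm ⟨(x, b), hb⟩)).fst =
    (C.emb.facePerm ⟨(x, b), hb⟩).snd := C.emb.rot_fst _
  have h5 : (C.emb.facePerm ⟨(x, b), hb⟩).fst = b := C.emb.rot_fst _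
  rw [h3] at h4
  have h6 := (C.emb.facePerm ⟨(x, b), hb⟩).adj
  rw [h5, ← h4] at h6
  exact h6.symm

/-- The vertex completing a facial triangle of the target over an inner dart is in the image. -/
theorem exists_apex_of_not_isOuter (hf : IsConfigHomMap C T f) {p q : A} {v : V}
    (hqp : C.graph.Adj p q) (hin : ¬ C.isOuter ⟨(p, q), hqp⟩)
    (hv : T.emb.FaceAt (f p) (f q) v) : ∃ t, C.graph.Adj q t ∧ f t = v := by
  obtain ⟨h, hdeg, hface⟩ := hf
  obtain ⟨h₁, h₂, hrot⟩ := hv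
  have h3 := dartMap_rot hface (d := ⟨(q, p), hqp.symm⟩) hin
  have h4 : dartMap f h (C.emb.rot ⟨(q, p), hqp.symm⟩) = ⟨(f q, v), h₂⟩ := h3.trans hrot
  refine ⟨(C.emb.rot ⟨(q, p), hqp.symm⟩).snd, ?_, congrArg (fun d : T.graph.Dart => d.snd) h4⟩
  have := (C.emb.rot ⟨(q, p), hqp.symm⟩).adj
  rwa [C.emb.rot_fst] at this

/-- A vertex of the target lying between two neighbours of `f q` is in the image if `q` has
external degree at least 2. -/
theorem exists_apex_of_two_le (hf : IsConfigHomMap C T f) {p q r : A} {v : V}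
    (hq : ¬ IsCutVertex C.graph q) (hqp : C.graph.Adj q p) (hqr : C.graph.Adj q r)
    (hδ : vdeg C.graph q + 2 ≤ C.δ q) (hp : T.emb.FaceAt (f p) (f q) v)
    (hr : T.emb.FaceAt v (f q) (f r)) : ∃ t, C.graph.Adj q t ∧ f t = v := by
  obtain ⟨h, hdeg, hface⟩ := hf
  obtain ⟨h₁, h₂, hrot⟩ := hp
  obtain ⟨h₃, h₄, hrot'⟩ := hr
  obtain ⟨e, he, heq⟩ := exists_dartMap_eq_rot (h := h) hdeg hface (d := ⟨(q, p), hqp⟩)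
    (d' := ⟨(q, r), hqr⟩) hq rfl hδ (by
      change T.emb.rot (T.emb.rot ⟨(f q, f p), h₁⟩) = ⟨(f q, f r), h₄⟩
      rw [hrot, ← hrot'])
  have h5 : dartMap f h e = ⟨(f q, v), h₂⟩ := heq.trans hrot
  refine ⟨e.snd, ?_, congrArg (fun d : T.graph.Dart => d.snd) h5⟩
  have := e.adj
  rwa [he] at this

end IsConfigHomMap

end Vertices

namespace PlaneTriangulation

variable {V : Type} [Fintype V] {T : PlaneTriangulation V} {S : Set V}

theorem faceAt_adj {p q r : V} (h : T.emb.FaceAt p q r) :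
    T.graph.Adj p q ∧ T.graph.Adj q r ∧ T.graph.Adj r p := by
  obtain ⟨h3, h4, -⟩ := faceAt_rotate h
  obtain ⟨h1, h2, -⟩ := h
  exact ⟨h1.symm, h2, h4⟩

theorem faceAt_of_triangle (hno : ¬ HasObstructingCycleIn T.graph S) {p q r : V}
    (hp : p ∈ S) (hq : q ∈ S) (hr : r ∈ S) (hpq : T.graph.Adj p q) (hqr : T.graph.Adj q r)
    (hrp : T.graph.Adj r p) : T.emb.FaceAt p q r ∨ T.emb.FaceAt r q p := by
  let c : T.graph.Walk p p := .cons hpq (.cons hqr (.cons hrp .nil))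
  have hc : c.IsCycle := by
    simp [c, Walk.isCycle_def, Walk.isTrail_def, hpq.ne, hpq.ne', hqr.ne, hrp.ne, hrp.ne']
  obtain ⟨v₀, h4, hface⟩ := T.exists_small_side c hc (by simp [c]) fun h =>
    hno ⟨p, c, h, by simp [c, hp, hq, hr]⟩
  have hv₀ := h4 (by simp [c])
  obtain ⟨v, hv, hf⟩ := hface p q (by simp [c])
  have hvs : v ∈ c.support := hv.elim id fun h => h ▸ hv₀
  simp only [c, Walk.support_cons, Walk.support_nil, List.mem_cons, List.not_mem_nil,
    or_false] at hvs
  rcases hf with hf | hf <;> obtain ⟨h1, h2, h3⟩ := faceAt_adj hf <;>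
    rcases hvs with rfl | rfl | rfl | rfl
  all_goals first
    | exact absurd rfl h1.ne
    | exact absurd rfl h2.ne
    | exact absurd rfl h3.ne
    | exact Or.inl hf
    | exact Or.inr (faceAt_rotate (faceAt_rotate hf))

theorem faceAt_of_square (hno : ¬ HasObstructingCycleIn T.graph S) {p q r s : V}
    (hp : p ∈ S) (hq : q ∈ S) (hr : r ∈ S) (hs : s ∈ S) (hpq : T.graph.Adj p q)
    (hqr : T.graph.Adj q r) (hrs : T.graph.Adj r s) (hsp : T.graph.Adj s p)
    (hpr : p ≠ r) (hqs : q ≠ s) :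
    (T.emb.FaceAt p q r ∨ T.emb.FaceAt r q p) ∨ (T.emb.FaceAt q r s ∨ T.emb.FaceAt s r q) := by
  let c : T.graph.Walk p p := .cons hpq (.cons hqr (.cons hrs (.cons hsp .nil)))
  have hc : c.IsCycle := by
    simp [c, Walk.isCycle_def, Walk.isTrail_def, hpq.ne, hpq.ne', hqr.ne, hrs.ne,
      hsp.ne, hsp.ne', hpr, hpr.symm, hqs]
  obtain ⟨v₀, h4, hface⟩ := T.exists_small_side c hc (by simp [c]) fun h =>
    hno ⟨p, c, h, by simp [c, hp, hq, hr, hs]⟩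
  have hv₀ := h4 (by simp [c])
  obtain ⟨v, hv, hf⟩ := hface q r (by simp [c])
  have hvs : v ∈ c.support := hv.elim id fun h => h ▸ hv₀
  simp only [c, Walk.support_cons, Walk.support_nil, List.mem_cons, List.not_mem_nil,
    or_false] at hvs
  rcases hf with hf | hf <;> obtain ⟨h1, h2, h3⟩ := faceAt_adj hf <;>
    rcases hvs with rfl | rfl | rfl | rfl | rfl
  all_goals first
    | exact absurd rfl h1.ne
    | exact absurd rfl h2.ne
    | exact absurd rfl h3.ne
    | exact Or.inl (Or.inl (faceAt_rotate (faceAt_rotate hf)))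
    | exact Or.inl (Or.inr (faceAt_rotate (faceAt_rotate hf)))
    | exact Or.inl (Or.inl (faceAt_rotate hf))
    | exact Or.inl (Or.inr (faceAt_rotate hf))
    | exact Or.inl (Or.inl hf)
    | exact Or.inl (Or.inr hf)
    | exact Or.inr (Or.inl hf)
    | exact Or.inr (Or.inr (faceAt_rotate (faceAt_rotate hf)))

/-- A chordless non-obstructing 5-cycle is the link of a vertex on one side. -/
theorem exists_apex_of_pentagon (hno : ¬ HasObstructingCycleIn T.graph S) {p q r s t : V}
    (hp : p ∈ S) (hq : q ∈ S) (hr : r ∈ S) (hs : s ∈ S) (ht : t ∈ S) (hpq : T.graph.Adj p q)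
    (hqr : T.graph.Adj q r) (hrs : T.graph.Adj r s) (hst : T.graph.Adj s t)
    (htp : T.graph.Adj t p) (hpr' : p ≠ r) (hps' : p ≠ s) (hqs' : q ≠ s) (hqt' : q ≠ t)
    (hrt' : r ≠ t) (hpr : ¬ T.graph.Adj p r) (hps : ¬ T.graph.Adj p s) (hqs : ¬ T.graph.Adj q s)
    (hqt : ¬ T.graph.Adj q t) (hrt : ¬ T.graph.Adj r t) :
    ∃ v, (T.emb.FaceAt p q v ∨ T.emb.FaceAt q p v) ∧ (T.emb.FaceAt q r v ∨ T.emb.FaceAt r q v) ∧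
      (T.emb.FaceAt r s v ∨ T.emb.FaceAt s r v) ∧ (T.emb.FaceAt s t v ∨ T.emb.FaceAt t s v) := by
  let c : T.graph.Walk p p := .cons hpq (.cons hqr (.cons hrs (.cons hst (.cons htp .nil))))
  have hc : c.IsCycle := by
    simp [c, Walk.isCycle_def, Walk.isTrail_def, hpq.ne, hpq.ne', hqr.ne, hrs.ne,
      hst.ne, htp.ne, htp.ne', hpr', hpr'.symm, hps', hps'.symm, hqs', hqt', hrt']
  obtain ⟨v₀, -, hface⟩ := T.exists_small_side c hc (by simp [c]) fun h =>
    hno ⟨p, c, h, by simp [c, hp, hq, hr, hs, ht]⟩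
  have key : ∀ a b, s(a, b) ∈ c.edges → (∀ v ∈ c.support, ¬ (T.graph.Adj v a ∧ T.graph.Adj v b)) →
      T.emb.FaceAt a b v₀ ∨ T.emb.FaceAt b a v₀ := by
    intro a b hab hnv
    obtain ⟨v, hv, hf⟩ := hface a b hab
    rcases hv with hv | rfl
    · rcases hf with hf | hf <;> obtain ⟨h1, h2, h3⟩ := faceAt_adj hf
      · exact (hnv v hv ⟨h3, h2.symm⟩).elim
      · exact (hnv v hv ⟨h2.symm, h3⟩).elim
    · exact hf
  refine ⟨v₀, key _ _ (by simp [c]) ?_, key _ _ (by simp [c]) ?_, key _ _ (by simp [c]) ?_,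
    key _ _ (by simp [c]) ?_⟩ <;>
  · simp only [c, Walk.support_cons, Walk.support_nil, List.mem_cons, List.not_mem_nil, or_false]
    rintro v (rfl | rfl | rfl | rfl | rfl | rfl) ⟨h1, h2⟩ <;>
    first
      | exact h1.ne rfl
      | exact h2.ne rfl
      | exact hpr h1
      | exact hpr h2
      | exact hpr h1.symm
      | exact hpr h2.symm
      | exact hps h1
      | exact hps h2
      | exact hps h1.symm
      | exact hps h2.symm
      | exact hqs h1
      | exact hqs h2
      | exact hqs h1.symm
      | exact hqs h2.symm
      | exact hqt h1
      | exact hqt h2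
      | exact hqt h1.symm
      | exact hqt h2.symm
      | exact hrt h1
      | exact hrt h2
      | exact hrt h1.symm

end PlaneTriangulation

namespace IsConfigHomMap

open PlaneTriangulation

variable {A V : Type} [Fintype A] [Fintype V] {C : Configuration A} {T : PlaneTriangulation V}
  {f : A → V}

theorem adj_of_path_two (hf : IsConfigHomMap C T f) (hnocut : ∀ v, ¬ IsCutVertex C.graph v)
    (hno : ¬ HasObstructingCycleIn T.graph (Set.range f)) {a x b : A} (hax : C.graph.Adj a x)
    (hxb : C.graph.Adj x b) (hab : T.graph.Adj (f a) (f b)) : C.graph.Adj a b := by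
  have h := hf.choose
  rcases faceAt_of_triangle hno ⟨a, rfl⟩ ⟨x, rfl⟩ ⟨b, rfl⟩ (h hax) (h hxb) hab.symm with hF | hF
  · exact hf.adj_of_faceAt (hnocut x) hax.symm hxb hF
  · exact (hf.adj_of_faceAt (hnocut x) hxb hax.symm hF).symm

theorem adj_of_path_three (hf : IsConfigHomMap C T f) (hnocut : ∀ v, ¬ IsCutVertex C.graph v)
    (hno : ¬ HasObstructingCycleIn T.graph (Set.range f)) {a x y b : A} (hax : C.graph.Adj a x)
    (hxy : C.graph.Adj x y) (hyb : C.graph.Adj y b) (hab : T.graph.Adj (f a) (f b)) :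
    C.graph.Adj a b := by
  have h := hf.choose
  by_cases hay : f a = f y
  · rwa [hf.eq_of_common_neighbor (hnocut x) hax.symm hxy hay]
  by_cases hxb : f x = f b
  · rwa [← hf.eq_of_common_neighbor (hnocut y) hxy.symm hyb hxb]
  have hcases : C.graph.Adj a y ∨ C.graph.Adj x b := by
    rcases faceAt_of_square hno ⟨a, rfl⟩ ⟨x, rfl⟩ ⟨y, rfl⟩ ⟨b, rfl⟩ (h hax) (h hxy) (h hyb)
      hab.symm hay hxb with (hF | hF) | (hF | hF)
    · exact Or.inl (hf.adj_of_faceAt (hnocut x) hax.symm hxy hF)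
    · exact Or.inl (hf.adj_of_faceAt (hnocut x) hxy hax.symm hF).symm
    · exact Or.inr (hf.adj_of_faceAt (hnocut y) hxy.symm hyb hF)
    · exact Or.inr (hf.adj_of_faceAt (hnocut y) hyb hxy.symm hF).symm
  rcases hcases with hay | hxb
  · exact hf.adj_of_path_two hnocut hno hay hyb hab
  · exact hf.adj_of_path_two hnocut hno hax hxb hab

theorem injective_of_dist_le_four (hf : IsConfigHomMap C T f)
    (hnocut : ∀ v, ¬ IsCutVertex C.graph v)
    (hno : ¬ HasObstructingCycleIn T.graph (Set.range f))
    (hdiam : ∀ a b : A, C.graph.dist a b ≤ 4) : Function.Injective f := by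
  intro u w huw
  have h := hf.choose
  obtain ⟨p, hp⟩ := C.conn.exists_walk_length_eq_dist u w
  have hlen : p.length ≤ 4 := hp ▸ hdiam u w
  clear hp
  match p, hlen with
  | .nil, _ => rfl
  | .cons h1 .nil, _ => exact absurd huw (h h1).ne
  | .cons h1 (.cons h2 .nil), _ => exact hf.eq_of_common_neighbor (hnocut _) h1.symm h2 huw
  | .cons h1 (.cons h2 (.cons h3 .nil)), _ =>
    have h4 := hf.adj_of_path_two hnocut hno h1 h2 (huw ▸ (h h3).symm)
    exact hf.eq_of_common_neighbor (hnocut _) h4.symm h3 huw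
  | .cons h1 (.cons h2 (.cons h3 (.cons h4 .nil))), _ =>
    have h5 := hf.adj_of_path_three hnocut hno h1 h2 h3 (huw ▸ (h h4).symm)
    exact hf.eq_of_common_neighbor (hnocut _) h5.symm h4 huw
  | .cons h1 (.cons h2 (.cons h3 (.cons h4 (.cons h5 p)))), hl =>
    simp only [Walk.length_cons] at hl
    omega

theorem adj_of_dist_le_three (hf : IsConfigHomMap C T f) (hnocut : ∀ v, ¬ IsCutVertex C.graph v)
    (hno : ¬ HasObstructingCycleIn T.graph (Set.range f)) {a b : A} (p : C.graph.Walk a b)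
    (hlen : p.length ≤ 3) (hab : T.graph.Adj (f a) (f b)) : C.graph.Adj a b := by
  match p, hlen with
  | .nil, _ => exact absurd rfl hab.ne
  | .cons h1 .nil, _ => exact h1
  | .cons h1 (.cons h2 .nil), _ => exact hf.adj_of_path_two hnocut hno h1 h2 hab
  | .cons h1 (.cons h2 (.cons h3 .nil)), _ => exact hf.adj_of_path_three hnocut hno h1 h2 h3 hab
  | .cons h1 (.cons h2 (.cons h3 (.cons h4 p))), hl =>
    simp only [Walk.length_cons] at hl
    omega

/-- If `v` completes a facial triangle over the image of an edge that is not on the outer face,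
then `v` is the image of a neighbour of an end of the edge. -/
theorem exists_apex_of_not_isOuterEdge (hf : IsConfigHomMap C T f) {p q : A} {v : V}
    (hpq : C.graph.Adj p q) (hin : ¬ C.toNearTriangulation.IsOuterEdge p q)
    (hv : T.emb.FaceAt (f p) (f q) v ∨ T.emb.FaceAt (f q) (f p) v) :
    ∃ t, C.graph.Adj q t ∧ f t = v ∨ C.graph.Adj p t ∧ f t = v := by
  rcases hv with hv | hv
  · obtain ⟨t, ht⟩ := hf.exists_apex_of_not_isOuter hpq (fun ho => hin ⟨_, ho, Or.inl rfl⟩) hv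
    exact ⟨t, Or.inl ht⟩
  · obtain ⟨t, ht⟩ := hf.exists_apex_of_not_isOuter hpq.symm
      (fun ho => hin ⟨_, ho, Or.inr rfl⟩) hv
    exact ⟨t, Or.inr ht⟩

/-- If `v` completes facial triangles over the images of two edges `pq` and `qr`, and `q` has
external degree at least 2, then `v` is the image of a neighbour of `q`. -/
theorem exists_apex_of_external_degree (hf : IsConfigHomMap C T f)
    (hnocut : ∀ v, ¬ IsCutVertex C.graph v) {p q r : A} {v : V}
    (hpq : C.graph.Adj p q) (hqr : C.graph.Adj q r) (hpr : f p ≠ f r)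
    (hδ : vdeg C.graph q + 2 ≤ C.δ q)
    (hv : T.emb.FaceAt (f p) (f q) v ∨ T.emb.FaceAt (f q) (f p) v)
    (hv' : T.emb.FaceAt (f q) (f r) v ∨ T.emb.FaceAt (f r) (f q) v) :
    ∃ t, C.graph.Adj q t ∧ f t = v := by
  rcases hv with hv | hv <;> rcases hv' with hv' | hv'
  · exact hf.exists_apex_of_two_le (hnocut q) hpq.symm hqr hδ hv
      (faceAt_rotate (faceAt_rotate hv'))
  · obtain ⟨h1, h2, h3⟩ := hv
    obtain ⟨h1', h2', h3'⟩ := hv'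
    have := T.emb.rot.injective (h3.trans h3'.symm)
    exact absurd (congrArg (fun d : T.graph.Dart => d.snd) this) hpr
  · obtain ⟨h1, h2, h3⟩ := faceAt_rotate (faceAt_rotate hv)
    obtain ⟨h1', h2', h3'⟩ := faceAt_rotate (faceAt_rotate hv')
    have := h3.symm.trans h3'
    exact absurd (congrArg (fun d : T.graph.Dart => d.snd) this) hpr
  · exact hf.exists_apex_of_two_le (hnocut q) hqr hpq.symm hδ hv'
      (faceAt_rotate (faceAt_rotate hv))

theorem adj_of_secondNbrCond (hf : IsConfigHomMap C T f) (hnocut : ∀ v, ¬ IsCutVertex C.graph v)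
    (hno : ¬ HasObstructingCycleIn T.graph (Set.range f))
    (hdiam : ∀ a b : A, C.graph.dist a b ≤ 4) (hC : SecondNbrCond C) {a b : A}
    (hab : T.graph.Adj (f a) (f b)) : C.graph.Adj a b := by
  have hinj := hf.injective_of_dist_le_four hnocut hno hdiam
  have h := hf.choose
  by_contra hnab
  have hfar : ∀ p : C.graph.Walk a b, 4 ≤ p.length := fun p => by
    by_contra hlt
    exact hnab (hf.adj_of_dist_le_three hnocut hno p (by omega) hab)
  have hdist : C.graph.dist a b = 4 := by
    obtain ⟨p, hp⟩ := C.conn.exists_walk_length_eq_dist a b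
    exact le_antisymm (hdiam a b) (hp ▸ hfar p)
  obtain ⟨p, hpath, hlen, hcond⟩ := hC a b hdist
  match p, hlen with
  | .cons (v := x) hax (.cons (v := y) hxy (.cons (v := z) hyz (.cons hzb .nil))), _ =>
  have hay : ¬ C.graph.Adj a y := fun hay => by
    simpa using hfar (.cons hay (.cons hyz (.cons hzb .nil)))
  have haz : ¬ C.graph.Adj a z := fun haz => by
    simpa using hfar (.cons haz (.cons hzb .nil))
  have hxz : ¬ C.graph.Adj x z := fun hxz => by
    simpa using hfar (.cons hax (.cons hxz (.cons hzb .nil)))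
  have hxb : ¬ C.graph.Adj x b := fun hxb => by
    simpa using hfar (.cons hax (.cons hxb .nil))
  have hyb : ¬ C.graph.Adj y b := fun hyb => by
    simpa using hfar (.cons hax (.cons hxy (.cons hyb .nil)))
  have hnodup := hpath.support_nodup
  simp only [Walk.support_cons, Walk.support_nil, List.nodup_cons, List.mem_cons,
    List.not_mem_nil, or_false, not_or, not_false_eq_true, List.nodup_nil, and_true] at hnodup
  obtain ⟨⟨-, hay', haz', -⟩, ⟨-, hxz', hxb'⟩, ⟨-, hyb'⟩, -⟩ := hnodup
  obtain ⟨v, hvax, hvxy, hvyz, hvzb⟩ := exists_apex_of_pentagon hno ⟨a, rfl⟩ ⟨x, rfl⟩ ⟨y, rfl⟩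
    ⟨z, rfl⟩ ⟨b, rfl⟩ (h hax) (h hxy) (h hyz) (h hzb) hab.symm (hinj.ne hay') (hinj.ne haz')
    (hinj.ne hxz') (hinj.ne hxb') (hinj.ne hyb')
    (fun hadj => hay (hf.adj_of_path_two hnocut hno hax hxy hadj))
    (fun hadj => haz (hf.adj_of_path_three hnocut hno hax hxy hyz hadj))
    (fun hadj => hxz (hf.adj_of_path_two hnocut hno hxy hyz hadj))
    (fun hadj => hxb (hf.adj_of_path_three hnocut hno hxy hyz hzb hadj))
    (fun hadj => hyb (hf.adj_of_path_two hnocut hno hyz hzb hadj))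
  have hadj : ∀ {p q : V}, T.emb.FaceAt p q v ∨ T.emb.FaceAt q p v →
      T.graph.Adj p v ∧ T.graph.Adj q v := by
    rintro p q (hF | hF) <;> obtain ⟨h1, h2, h3⟩ := faceAt_adj hF
    · exact ⟨h3.symm, h2⟩
    · exact ⟨h2, h3.symm⟩
  have hout : ∀ t, f t = v → ¬ C.graph.Adj a t ∧ ¬ C.graph.Adj x t ∧ ¬ C.graph.Adj y t ∧
      ¬ C.graph.Adj z t ∧ ¬ C.graph.Adj b t := by
    rintro t rfl
    have step : ∀ {p q : A}, C.graph.Adj p q → T.graph.Adj (f q) (f t) → C.graph.Adj p t →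
        C.graph.Adj q t := fun hpq hqt hpt =>
      hf.adj_of_path_two hnocut hno hpq.symm hpt hqt
    have h1 := step hax (hadj hvax).2
    have h2 := step hxy (hadj hvxy).2
    have h3 := step hyz (hadj hvyz).2
    have h4 := step hzb (hadj hvzb).2
    have h1' := step hax.symm (hadj hvax).1
    have h2' := step hxy.symm (hadj hvxy).1
    have h3' := step hyz.symm (hadj hvyz).1
    have h4' := step hzb.symm (hadj hvzb).1
    have hend : ¬ (C.graph.Adj a t ∧ C.graph.Adj b t) := fun ⟨hat, hbt⟩ => by
      simpa using hfar (.cons hat (.cons hbt.symm .nil))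
    exact ⟨fun ha => hend ⟨ha, h4 (h3 (h2 (h1 ha)))⟩,
      fun hx => hend ⟨h1' hx, h4 (h3 (h2 hx))⟩,
      fun hy => hend ⟨h1' (h2' hy), h4 (h3 hy)⟩,
      fun hz => hend ⟨h1' (h2' (h3' hz)), h4 hz⟩,
      fun hb => hend ⟨h1' (h2' (h3' (h4' hb))), hb⟩⟩
  rcases hcond with hcond | ⟨q, hq, hqa, hqb, -, hδ⟩
  · apply hcond
    intro d hd
    by_contra hin
    have hcase : ∀ {p q : A}, C.graph.Adj p q → ¬ C.toNearTriangulation.IsOuterEdge p q →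
        (T.emb.FaceAt (f p) (f q) v ∨ T.emb.FaceAt (f q) (f p) v) →
        ∃ t, f t = v ∧ (C.graph.Adj p t ∨ C.graph.Adj q t) := fun hpq hin hv => by
      obtain ⟨t, ⟨ht, htv⟩ | ⟨ht, htv⟩⟩ := hf.exists_apex_of_not_isOuterEdge hpq hin hv
      · exact ⟨t, htv, Or.inr ht⟩
      · exact ⟨t, htv, Or.inl ht⟩
    simp only [Walk.darts_cons, Walk.darts_nil, List.mem_cons, List.not_mem_nil, or_false] at hd
    rcases hd with rfl | rfl | rfl | rfl
    · obtain ⟨t, htv, ht⟩ := hcase hax hin hvax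
      exact ht.elim (hout t htv).1 (hout t htv).2.1
    · obtain ⟨t, htv, ht⟩ := hcase hxy hin hvxy
      exact ht.elim (hout t htv).2.1 (hout t htv).2.2.1
    · obtain ⟨t, htv, ht⟩ := hcase hyz hin hvyz
      exact ht.elim (hout t htv).2.2.1 (hout t htv).2.2.2.1
    · obtain ⟨t, htv, ht⟩ := hcase hzb hin hvzb
      exact ht.elim (hout t htv).2.2.2.1 (hout t htv).2.2.2.2
  · simp only [Walk.support_cons, Walk.support_nil, List.mem_cons, List.not_mem_nil,
      or_false] at hq
    rcases hq with rfl | rfl | rfl | rfl | rfl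
    · exact hqa rfl
    · obtain ⟨t, ht, htv⟩ := hf.exists_apex_of_external_degree hnocut hax hxy (hinj.ne hay') hδ
        hvax hvxy
      exact (hout t htv).2.1 ht
    · obtain ⟨t, ht, htv⟩ := hf.exists_apex_of_external_degree hnocut hxy hyz (hinj.ne hxz') hδ
        hvxy hvyz
      exact (hout t htv).2.2.1 ht
    · obtain ⟨t, ht, htv⟩ := hf.exists_apex_of_external_degree hnocut hyz hzb (hinj.ne hyb') hδ
        hvyz hvzb
      exact (hout t htv).2.2.2.1 ht
    · exact hqb rfl

end IsConfigHomMap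

end FourColor

open FourColor in
/-- Let `(Z, δ)` be a configuration of diameter at most 4
with no cut-vertex, `G` a planar triangulation and `f` an orientation-preserving
homomorphism of `(Z, δ)` into `G`.  If `G` has no obstructing cycle all of
whose vertices lie in `f(V(Z))`, then `f` is injective — so `(Z, δ)` is
contained in `G` via the embedding `f` — and moreover, if `(Z, δ)` also
satisfies the length-4 path condition (ii), then `(Z, δ)` is induced in `G`. -/
theorem homomorphism_is_embedding
    {A V : Type} [Fintype A] [Fintype V]
    (C : Configuration A) (T : PlaneTriangulation V)
    (hnocut : ∀ v : A, ¬ IsCutVertex C.graph v)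
    (hdiam : ∀ a b : A, C.graph.dist a b ≤ 4)
    (f : A → V) (hf : IsConfigHomMap C T f)
    (hno : ¬ ∃ (x : V) (c : T.graph.Walk x x),
      IsObstructingCycle c ∧ ∀ y ∈ c.support, y ∈ Set.range f) :
    Function.Injective f ∧
      (SecondNbrCond C → ∀ a b : A, T.graph.Adj (f a) (f b) → C.graph.Adj a b) := by
  have hno' : ¬ HasObstructingCycleIn T.graph (Set.range f) := hno
  exact ⟨hf.injective_of_dist_le_four hnocut hno' hdiam,
    fun hC _ _ hab => hf.adj_of_secondNbrCond hnocut hno' hdiam hC hab⟩
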